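/- arXiv:2312.10364 — 3 statements merged into one kernel-verified Lean document; each statement's English description precedes it below -/
import Mathlib

section
/- Assume the comparison principle (CP) holds for the level-set horizontal curvature flow. Let C ∈ ℝ, let û₀ ∈ C(ℍ) be uniformly h-quasiconvex in ℍ and satisfy û₀(p) ≤ L(|p|_G⁴ + 1) for all p ∈ ℍ and some L > 0, and set u₀ = min{û₀, C}. Assume u₀ ≤ C in ℍ and u₀ = C outside a compact set of ℍ. Let u ∈ C(ℍ×[0,∞)) be the unique viscosity solution of the level-set horizontal curvature flow with u(·,0) = u₀, satisfying u ≤ C and u = C outside K×[0,∞) for some compact K ⊂ ℍ. Then u(·,t) is h-quasiconvex in ℍ for every t ≥ 0. -/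
open Filter Topology

noncomputable section

abbrev Heis := ℝ × ℝ × ℝ

def hMul (p q : Heis) : Heis :=
  (p.1 + q.1, p.2.1 + q.2.1, p.2.2 + q.2.2 + (p.1 * q.2.1 - q.1 * p.2.1) / 2)

def horiz : Set Heis := {h : Heis | h.2.2 = 0}

def hPlane (p : Heis) : Set Heis := {q : Heis | ∃ h ∈ horiz, q = hMul p h}

def hSeg (p q : Heis) : Set Heis :=
  {w : Heis | ∃ l : ℝ, 0 ≤ l ∧ l ≤ 1 ∧ w = l • p + (1 - l) • q}

def HConvex (E : Set Heis) : Prop :=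
  ∀ p ∈ E, ∀ q ∈ E, q ∈ hPlane p → hSeg p q ⊆ E

def HQuasiconvexOn (f : Heis → ℝ) (Ω : Set Heis) : Prop :=
  ∀ p ∈ Ω, ∀ q ∈ Ω, q ∈ hPlane p → ∀ w ∈ hSeg p q, f w ≤ max (f p) (f q)

def X1 (f : Heis → ℝ) (p : Heis) : ℝ :=
  fderiv ℝ f p (1, 0, 0) - p.2.1 / 2 * fderiv ℝ f p (0, 0, 1)

def X2 (f : Heis → ℝ) (p : Heis) : ℝ :=
  fderiv ℝ f p (0, 1, 0) + p.1 / 2 * fderiv ℝ f p (0, 0, 1)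

def gradH (f : Heis → ℝ) (p : Heis) : ℝ × ℝ := (X1 f p, X2 f p)

def hessH (f : Heis → ℝ) (p : Heis) : ℝ × ℝ × ℝ :=
  (X1 (X1 f) p, (X1 (X2 f) p + X2 (X1 f) p) / 2, X2 (X2 f) p)

def L0H (ξ : ℝ × ℝ) (A : ℝ × ℝ × ℝ) : ℝ :=
  sInf {m : ℝ | ∃ η : ℝ × ℝ, η.1 ^ 2 + η.2 ^ 2 = 1 ∧ ξ.1 * η.1 + ξ.2 * η.2 = 0 ∧
    m = A.1 * η.1 ^ 2 + 2 * A.2.1 * η.1 * η.2 + A.2.2 * η.2 ^ 2}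

def Lop (f : Heis → ℝ) (p : Heis) : ℝ := L0H (gradH f p) (hessH f p)

def LbarOp (f : Heis → ℝ) (p : Heis) : ℝ := limsup (Lop f) (𝓝 p)

def LstarOp (f : Heis → ℝ) (p : Heis) : ℝ :=
  limsup (fun q : (ℝ × ℝ) × ℝ × ℝ × ℝ => L0H q.1 q.2) (𝓝 (gradH f p, hessH f p))

def StrictLocalMaxOnSet (g : Heis → ℝ) (Ω : Set Heis) (p : Heis) : Prop :=
  ∃ U ∈ 𝓝 p, ∀ q ∈ U ∩ Ω, q ≠ p → g q < g p

def UniformlyHQuasiconvexOn (f : Heis → ℝ) (Ω : Set Heis) (r₀ lam : ℝ) : Prop :=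
  ∀ r : ℝ, 0 < r → r < r₀ → ∀ p ∈ Ω, ∀ v ∈ horiz, v.1 ^ 2 + v.2.1 ^ 2 = 1 →
    hMul p (r • v) ∈ Ω → hMul p (-(r • v)) ∈ Ω →
    f p ≤ max (f (hMul p (r • v))) (f (hMul p (-(r • v)))) - lam * r ^ 2

def gaugeK (p : Heis) : ℝ := ((p.1 ^ 2 + p.2.1 ^ 2) ^ 2 + 16 * p.2.2 ^ 2) ^ ((1 : ℝ) / 4)


/-- The horizontal curvature operator `F(ξ, A) = -tr((I - ξ⊗ξ/|ξ|²) A)`,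
where `A = (a, b, c)` encodes the symmetric matrix `[[a,b],[b,c]]`. -/
def Fcurv (ξ : ℝ × ℝ) (A : ℝ × ℝ × ℝ) : ℝ :=
  -(A.1 + A.2.2) +
    (A.1 * ξ.1 ^ 2 + 2 * A.2.1 * ξ.1 * ξ.2 + A.2.2 * ξ.2 ^ 2) / (ξ.1 ^ 2 + ξ.2 ^ 2)

/-- Upper semicontinuous envelope `F*` of `Fcurv` (relative to `ξ ≠ 0`). -/
def FcurvUpper (ξ : ℝ × ℝ) (A : ℝ × ℝ × ℝ) : ℝ :=
  limsup (fun q : (ℝ × ℝ) × ℝ × ℝ × ℝ => Fcurv q.1 q.2)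
    (𝓝[{q : (ℝ × ℝ) × ℝ × ℝ × ℝ | q.1 ≠ 0}] (ξ, A))

/-- Lower semicontinuous envelope `F_*` of `Fcurv` (relative to `ξ ≠ 0`). -/
def FcurvLower (ξ : ℝ × ℝ) (A : ℝ × ℝ × ℝ) : ℝ :=
  liminf (fun q : (ℝ × ℝ) × ℝ × ℝ × ℝ => Fcurv q.1 q.2)
    (𝓝[{q : (ℝ × ℝ) × ℝ × ℝ × ℝ | q.1 ≠ 0}] (ξ, A))

/-- Viscosity subsolution of the level-set horizontal curvature flow
`u_t + F_*(∇_H u, (∇²_H u)*) ≤ 0` in `ℍ × (0, ∞)`. -/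
def FlowSubsolution (u : Heis × ℝ → ℝ) : Prop :=
  ∀ φ : Heis × ℝ → ℝ, ContDiff ℝ (⊤ : ℕ∞) φ → ∀ p : Heis, ∀ t : ℝ, 0 < t →
    (∃ U ∈ 𝓝 ((p, t) : Heis × ℝ), ∀ q ∈ U, 0 < q.2 → q ≠ (p, t) →
      u q - φ q < u (p, t) - φ (p, t)) →
    deriv (fun s => φ (p, s)) t +
      FcurvLower (gradH (fun w => φ (w, t)) p) (hessH (fun w => φ (w, t)) p) ≤ 0

/-- Viscosity supersolution of the level-set horizontal curvature flow. -/
def FlowSupersolution (u : Heis × ℝ → ℝ) : Prop :=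
  ∀ φ : Heis × ℝ → ℝ, ContDiff ℝ (⊤ : ℕ∞) φ → ∀ p : Heis, ∀ t : ℝ, 0 < t →
    (∃ U ∈ 𝓝 ((p, t) : Heis × ℝ), ∀ q ∈ U, 0 < q.2 → q ≠ (p, t) →
      u (p, t) - φ (p, t) < u q - φ q) →
    0 ≤ deriv (fun s => φ (p, s)) t +
      FcurvUpper (gradH (fun w => φ (w, t)) p) (hessH (fun w => φ (w, t)) p)

/-- The comparison principle (CP) for the level-set horizontal curvature flow. -/
def CPholds : Prop :=
  ∀ (C : ℝ) (K : Set Heis), IsCompact K →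
    ∀ u v : Heis × ℝ → ℝ,
      UpperSemicontinuousOn u {q : Heis × ℝ | 0 ≤ q.2} →
      LowerSemicontinuousOn v {q : Heis × ℝ | 0 ≤ q.2} →
      FlowSubsolution u → FlowSupersolution v →
      (∀ q : Heis × ℝ, 0 ≤ q.2 → u q ≤ C ∧ v q ≤ C) →
      (∀ q : Heis × ℝ, 0 ≤ q.2 → q.1 ∉ K → u q = C ∧ v q = C) →
      (∀ p : Heis, u (p, 0) ≤ v (p, 0)) →
      ∀ q : Heis × ℝ, 0 ≤ q.2 → u q ≤ v q

/-- The point `p · (w.1, w.2, 0)`. -/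
def move (p : Heis) (w : ℝ × ℝ) : Heis :=
  (p.1 + w.1, p.2.1 + w.2, p.2.2 + (p.1 * w.2 - w.1 * p.2.1) / 2)

/-- The quadratic form of the symmetric matrix `[[a, b], [b, c]]` encoded by `A = (a, b, c)`. -/
def quadForm (A : ℝ × ℝ × ℝ) (v : ℝ × ℝ) : ℝ :=
  A.1 * v.1 ^ 2 + 2 * A.2.1 * v.1 * v.2 + A.2.2 * v.2 ^ 2

section Envelopes

lemma Fcurv_perp (A : ℝ × ℝ × ℝ) {v : ℝ × ℝ} (hv : v.1 ^ 2 + v.2 ^ 2 = 1) {c : ℝ} (hc : c ≠ 0) :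
    Fcurv (c * -v.2, c * v.1) A = -quadForm A v := by
  have h : (c * -v.2) ^ 2 + (c * v.1) ^ 2 = c ^ 2 := by
    linear_combination c ^ 2 * hv
  simp only [Fcurv, quadForm, h]
  field_simp
  linear_combination (A.1 + A.2.2) * hv

lemma abs_Fcurv_le (ξ : ℝ × ℝ) (A : ℝ × ℝ × ℝ) (hξ : ξ ≠ 0) :
    |Fcurv ξ A| ≤ 2 * (|A.1| + |A.2.1| + |A.2.2|) := by
  have hpos : 0 < ξ.1 ^ 2 + ξ.2 ^ 2 := by
    rcases eq_or_ne ξ.1 0 with h1 | h1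
    · have h2 : ξ.2 ≠ 0 := fun h2 => hξ (Prod.ext h1 h2)
      positivity
    · positivity
  have key : |(A.1 * ξ.1 ^ 2 + 2 * A.2.1 * ξ.1 * ξ.2 + A.2.2 * ξ.2 ^ 2) / (ξ.1 ^ 2 + ξ.2 ^ 2)|
      ≤ |A.1| + |A.2.1| + |A.2.2| := by
    rw [abs_div, abs_of_pos hpos, div_le_iff₀ hpos]
    have h12 : |2 * ξ.1 * ξ.2| ≤ ξ.1 ^ 2 + ξ.2 ^ 2 := by
      rw [abs_le]; constructor <;> nlinarith [sq_nonneg (ξ.1 + ξ.2), sq_nonneg (ξ.1 - ξ.2)]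
    calc |A.1 * ξ.1 ^ 2 + 2 * A.2.1 * ξ.1 * ξ.2 + A.2.2 * ξ.2 ^ 2|
        ≤ |A.1 * ξ.1 ^ 2| + |A.2.1 * (2 * ξ.1 * ξ.2)| + |A.2.2 * ξ.2 ^ 2| := by
          rw [show 2 * A.2.1 * ξ.1 * ξ.2 = A.2.1 * (2 * ξ.1 * ξ.2) by ring]
          exact abs_add_three _ _ _
      _ ≤ |A.1| * (ξ.1 ^ 2 + ξ.2 ^ 2) + |A.2.1| * (ξ.1 ^ 2 + ξ.2 ^ 2)
          + |A.2.2| * (ξ.1 ^ 2 + ξ.2 ^ 2) := by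
          rw [abs_mul A.1, abs_mul A.2.1, abs_mul A.2.2, abs_of_nonneg (sq_nonneg ξ.1),
            abs_of_nonneg (sq_nonneg ξ.2)]
          gcongr <;> nlinarith [sq_nonneg ξ.1, sq_nonneg ξ.2]
      _ = _ := by ring
  unfold Fcurv
  have h1 := abs_add_le (-(A.1 + A.2.2))
    ((A.1 * ξ.1 ^ 2 + 2 * A.2.1 * ξ.1 * ξ.2 + A.2.2 * ξ.2 ^ 2) / (ξ.1 ^ 2 + ξ.2 ^ 2))
  have h2 : |-(A.1 + A.2.2)| ≤ |A.1| + |A.2.2| := by rw [abs_neg]; exact abs_add_le _ _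
  have := abs_nonneg A.2.1
  linarith

lemma exists_eventually_abs_Fcurv_le (ξ : ℝ × ℝ) (A : ℝ × ℝ × ℝ) :
    ∃ M, ∀ᶠ q : (ℝ × ℝ) × ℝ × ℝ × ℝ in 𝓝[{q | q.1 ≠ 0}] (ξ, A), |Fcurv q.1 q.2| ≤ M := by
  refine ⟨2 * (|A.1| + |A.2.1| + |A.2.2|) + 1, ?_⟩
  have hc : Continuous fun q : (ℝ × ℝ) × ℝ × ℝ × ℝ =>
      2 * (|q.2.1| + |q.2.2.1| + |q.2.2.2|) := by fun_prop
  have := hc.tendsto (ξ, A) |>.eventually (gt_mem_nhds (lt_add_one _))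
  filter_upwards [nhdsWithin_le_nhds this, self_mem_nhdsWithin] with q h1 h2
  exact (abs_Fcurv_le q.1 q.2 h2).trans h1.le

lemma frequently_Fcurv_eq {ξ v : ℝ × ℝ} (A : ℝ × ℝ × ℝ) (hv : v.1 ^ 2 + v.2 ^ 2 = 1)
    (hξ : ξ.1 * v.1 + ξ.2 * v.2 = 0) :
    ∃ᶠ q : (ℝ × ℝ) × ℝ × ℝ × ℝ in 𝓝[{q | q.1 ≠ 0}] (ξ, A), Fcurv q.1 q.2 = -quadForm A v := by
  set c := -ξ.1 * v.2 + ξ.2 * v.1 with hc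
  have hξ' : ξ = (c * -v.2, c * v.1) := by
    refine Prod.ext ?_ ?_ <;> simp only [hc]
    · linear_combination (-ξ.1) * hv + v.1 * hξ
    · linear_combination (-ξ.2) * hv + v.2 * hξ
  have hcont : Continuous fun d : ℝ => (((d * -v.2, d * v.1), A) : (ℝ × ℝ) × ℝ × ℝ × ℝ) := by
    fun_prop
  have ht : Tendsto (fun d : ℝ => (((d * -v.2, d * v.1), A) : (ℝ × ℝ) × ℝ × ℝ × ℝ))
      (𝓝[{0}ᶜ] c) (𝓝[{q | q.1 ≠ 0}] (ξ, A)) := by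
    refine tendsto_nhdsWithin_iff.2 ⟨?_, ?_⟩
    · have := (hcont.tendsto c).mono_left (nhdsWithin_le_nhds (s := ({0}ᶜ : Set ℝ)))
      rwa [← hξ'] at this
    · filter_upwards [self_mem_nhdsWithin] with d hd h0
      rw [Prod.ext_iff] at h0
      have hd : d ≠ 0 := hd
      simp [hd] at h0
      rw [h0.1, h0.2] at hv
      norm_num at hv
  have hne : (𝓝[{0}ᶜ] c).NeBot := mem_closure_iff_nhdsWithin_neBot.1 (dense_compl_singleton 0 c)
  refine ht.frequently (Eventually.frequently ?_)
  filter_upwards [self_mem_nhdsWithin] with d hd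
  exact Fcurv_perp A hv hd

lemma FcurvLower_le {ξ v : ℝ × ℝ} (A : ℝ × ℝ × ℝ) (hv : v.1 ^ 2 + v.2 ^ 2 = 1)
    (hξ : ξ.1 * v.1 + ξ.2 * v.2 = 0) : FcurvLower ξ A ≤ -quadForm A v := by
  obtain ⟨M, hM⟩ := exists_eventually_abs_Fcurv_le ξ A
  exact liminf_le_of_frequently_le ((frequently_Fcurv_eq A hv hξ).mono fun q h => h.le)
    ⟨-M, by rw [eventually_map]; exact hM.mono fun q h => (abs_le.1 h).1⟩

lemma le_FcurvUpper {ξ v : ℝ × ℝ} (A : ℝ × ℝ × ℝ) (hv : v.1 ^ 2 + v.2 ^ 2 = 1)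
    (hξ : ξ.1 * v.1 + ξ.2 * v.2 = 0) : -quadForm A v ≤ FcurvUpper ξ A := by
  obtain ⟨M, hM⟩ := exists_eventually_abs_Fcurv_le ξ A
  exact le_limsup_of_frequently_le ((frequently_Fcurv_eq A hv hξ).mono fun q h => h.ge)
    ⟨M, by rw [eventually_map]; exact hM.mono fun q h => (abs_le.1 h).2⟩

end Envelopes

section HorizontalTaylor

/-- The horizontal derivative `X₁` acting on the space variable of a function of space and time. -/
def Y1 (φ : Heis × ℝ → ℝ) (x : Heis × ℝ) : ℝ := X1 (fun w => φ (w, x.2)) x.1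

/-- The horizontal derivative `X₂` acting on the space variable of a function of space and time. -/
def Y2 (φ : Heis × ℝ → ℝ) (x : Heis × ℝ) : ℝ := X2 (fun w => φ (w, x.2)) x.1

/-- The time derivative of a function of space and time. -/
def Dt (φ : Heis × ℝ → ℝ) (x : Heis × ℝ) : ℝ := fderiv ℝ φ x (0, 1)

/-- The curve `s ↦ (p · sv, t - s² / 2)` through `x = (p, t)`. -/
def curve (x : Heis × ℝ) (v : ℝ × ℝ) (s : ℝ) : Heis × ℝ := (move x.1 (s • v), x.2 - s ^ 2 / 2)

/-- The derivative of `φ` along `curve x v`. -/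
def curveDeriv (φ : Heis × ℝ → ℝ) (x : Heis × ℝ) (v : ℝ × ℝ) (s : ℝ) : ℝ :=
  v.1 * Y1 φ (curve x v s) + v.2 * Y2 φ (curve x v s) - s * Dt φ (curve x v s)

/-- The second derivative of `φ` along `curve x v`. -/
def curveDeriv2 (φ : Heis × ℝ → ℝ) (x : Heis × ℝ) (v : ℝ × ℝ) (s : ℝ) : ℝ :=
  v.1 * curveDeriv (Y1 φ) x v s + v.2 * curveDeriv (Y2 φ) x v s -
    (Dt φ (curve x v s) + s * curveDeriv (Dt φ) x v s)

lemma curve_zero (x : Heis × ℝ) (v : ℝ × ℝ) : curve x v 0 = x := by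
  simp [curve, move]

lemma fderiv_slice {φ : Heis × ℝ → ℝ} (hφ : ContDiff ℝ (⊤ : ℕ∞) φ) (x : Heis × ℝ) (h : Heis) :
    fderiv ℝ (fun w => φ (w, x.2)) x.1 h = fderiv ℝ φ x (h, 0) := by
  have h1 : HasFDerivAt φ (fderiv ℝ φ x) (x.1, x.2) :=
    (hφ.differentiable (by simp) x).hasFDerivAt
  have h2 := HasFDerivAt.comp (f := fun w => (w, x.2)) x.1 h1 (hasFDerivAt_prodMk_left x.1 x.2)
  rw [show (fun w => φ (w, x.2)) = φ ∘ fun w => (w, x.2) from rfl, h2.fderiv]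
  simp

lemma Y1_eq {φ : Heis × ℝ → ℝ} (hφ : ContDiff ℝ (⊤ : ℕ∞) φ) (x : Heis × ℝ) :
    Y1 φ x = fderiv ℝ φ x ((1, 0, 0), 0) - x.1.2.1 / 2 * fderiv ℝ φ x ((0, 0, 1), 0) := by
  simp only [Y1, X1, fderiv_slice hφ]

lemma Y2_eq {φ : Heis × ℝ → ℝ} (hφ : ContDiff ℝ (⊤ : ℕ∞) φ) (x : Heis × ℝ) :
    Y2 φ x = fderiv ℝ φ x ((0, 1, 0), 0) + x.1.1 / 2 * fderiv ℝ φ x ((0, 0, 1), 0) := by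
  simp only [Y2, X2, fderiv_slice hφ]

lemma contDiff_fderiv_apply {φ : Heis × ℝ → ℝ} (hφ : ContDiff ℝ (⊤ : ℕ∞) φ) (h : Heis × ℝ) :
    ContDiff ℝ (⊤ : ℕ∞) fun x => fderiv ℝ φ x h :=
  (hφ.fderiv_right (m := (⊤ : ℕ∞)) (by simp)).clm_apply contDiff_const

lemma contDiff_Y1 {φ : Heis × ℝ → ℝ} (hφ : ContDiff ℝ (⊤ : ℕ∞) φ) :
    ContDiff ℝ (⊤ : ℕ∞) (Y1 φ) := by
  rw [show Y1 φ = _ from funext (Y1_eq hφ)]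
  have h1 := contDiff_fderiv_apply hφ ((1, 0, 0), 0)
  have h2 := contDiff_fderiv_apply hφ ((0, 0, 1), 0)
  fun_prop

lemma contDiff_Y2 {φ : Heis × ℝ → ℝ} (hφ : ContDiff ℝ (⊤ : ℕ∞) φ) :
    ContDiff ℝ (⊤ : ℕ∞) (Y2 φ) := by
  rw [show Y2 φ = _ from funext (Y2_eq hφ)]
  have h1 := contDiff_fderiv_apply hφ ((0, 1, 0), 0)
  have h2 := contDiff_fderiv_apply hφ ((0, 0, 1), 0)
  fun_prop

lemma contDiff_Dt {φ : Heis × ℝ → ℝ} (hφ : ContDiff ℝ (⊤ : ℕ∞) φ) :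
    ContDiff ℝ (⊤ : ℕ∞) (Dt φ) :=
  contDiff_fderiv_apply hφ (0, 1)

lemma deriv_time {φ : Heis × ℝ → ℝ} (hφ : ContDiff ℝ (⊤ : ℕ∞) φ) (x : Heis × ℝ) :
    deriv (fun s => φ (x.1, s)) x.2 = Dt φ x := by
  have h1 : HasFDerivAt φ (fderiv ℝ φ x) (x.1, x.2) :=
    (hφ.differentiable (by simp) x).hasFDerivAt
  have h2 := HasFDerivAt.comp (f := fun s => (x.1, s)) x.2 h1 (hasFDerivAt_prodMk_right x.1 x.2)
  have h3 := h2.hasDerivAt.deriv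
  simpa [Function.comp_def, Dt] using h3

lemma continuous_curve :
    Continuous fun q : (Heis × ℝ) × (ℝ × ℝ) × ℝ => curve q.1 q.2.1 q.2.2 := by
  simp only [curve, move, Prod.smul_fst, Prod.smul_snd, smul_eq_mul]
  fun_prop

lemma continuous_curveDeriv {φ : Heis × ℝ → ℝ} (hφ : ContDiff ℝ (⊤ : ℕ∞) φ) :
    Continuous fun q : (Heis × ℝ) × (ℝ × ℝ) × ℝ => curveDeriv φ q.1 q.2.1 q.2.2 := by
  have h1 := (contDiff_Y1 hφ).continuous.comp continuous_curve
  have h2 := (contDiff_Y2 hφ).continuous.comp continuous_curve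
  have h3 := (contDiff_Dt hφ).continuous.comp continuous_curve
  simp only [Function.comp_def] at h1 h2 h3
  unfold curveDeriv
  fun_prop

lemma continuous_curveDeriv2 {φ : Heis × ℝ → ℝ} (hφ : ContDiff ℝ (⊤ : ℕ∞) φ) :
    Continuous fun q : (Heis × ℝ) × (ℝ × ℝ) × ℝ => curveDeriv2 φ q.1 q.2.1 q.2.2 := by
  have h1 := continuous_curveDeriv (contDiff_Y1 hφ)
  have h2 := continuous_curveDeriv (contDiff_Y2 hφ)
  have h3 := (contDiff_Dt hφ).continuous.comp continuous_curve
  have h4 := continuous_curveDeriv (contDiff_Dt hφ)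
  simp only [Function.comp_def] at h3
  unfold curveDeriv2
  fun_prop

lemma hasDerivAt_curve (x : Heis × ℝ) (v : ℝ × ℝ) (s : ℝ) :
    HasDerivAt (curve x v) ((v.1, v.2, (x.1.1 * v.2 - v.1 * x.1.2.1) / 2), -s) s := by
  have h1 : HasDerivAt (fun s : ℝ => x.1.1 + s * v.1) v.1 s := by
    simpa using ((hasDerivAt_id s).mul_const v.1).const_add x.1.1
  have h2 : HasDerivAt (fun s : ℝ => x.1.2.1 + s * v.2) v.2 s := by
    simpa using ((hasDerivAt_id s).mul_const v.2).const_add x.1.2.1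
  have h3 : HasDerivAt (fun s : ℝ => x.1.2.2 + (x.1.1 * (s * v.2) - s * v.1 * x.1.2.1) / 2)
      ((x.1.1 * v.2 - v.1 * x.1.2.1) / 2) s := by
    have := ((hasDerivAt_id s).mul_const ((x.1.1 * v.2 - v.1 * x.1.2.1) / 2)).const_add x.1.2.2
    simp only [id, one_mul] at this
    refine this.congr_of_eventuallyEq (Eventually.of_forall fun s => ?_)
    ring
  have h4 : HasDerivAt (fun s : ℝ => x.2 - s ^ 2 / 2) (-s) s := by
    have := ((hasDerivAt_pow 2 s).div_const 2).const_sub x.2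
    refine this.congr_deriv ?_
    simp
  exact (h1.prodMk (h2.prodMk h3)).prodMk h4

lemma hasDerivAt_comp_curve {φ : Heis × ℝ → ℝ} (hφ : ContDiff ℝ (⊤ : ℕ∞) φ) (x : Heis × ℝ)
    (v : ℝ × ℝ) (s : ℝ) :
    HasDerivAt (fun s => φ (curve x v s)) (curveDeriv φ x v s) s := by
  have h1 : HasFDerivAt φ (fderiv ℝ φ (curve x v s)) (curve x v s) :=
    (hφ.differentiable (by simp) _).hasFDerivAt
  have h2 := h1.comp_hasDerivAt s (hasDerivAt_curve x v s)
  refine h2.congr_deriv ?_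
  have hdec : (((v.1, v.2, (x.1.1 * v.2 - v.1 * x.1.2.1) / 2), -s) : Heis × ℝ) =
      v.1 • ((1, 0, 0), 0) + v.2 • ((0, 1, 0), 0) +
      ((x.1.1 * v.2 - v.1 * x.1.2.1) / 2) • ((0, 0, 1), 0) - s • (0, 1) := by
    ext <;> simp
  rw [hdec, map_sub, map_add, map_add, map_smul, map_smul, map_smul, map_smul, curveDeriv,
    Y1_eq hφ, Y2_eq hφ, Dt]
  simp only [curve, move, Prod.smul_fst, Prod.smul_snd, smul_eq_mul]
  ring

lemma hasDerivAt_curveDeriv {φ : Heis × ℝ → ℝ} (hφ : ContDiff ℝ (⊤ : ℕ∞) φ) (x : Heis × ℝ)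
    (v : ℝ × ℝ) (s : ℝ) :
    HasDerivAt (curveDeriv φ x v) (curveDeriv2 φ x v s) s := by
  have h1 := (hasDerivAt_comp_curve (contDiff_Y1 hφ) x v s).const_mul v.1
  have h2 := (hasDerivAt_comp_curve (contDiff_Y2 hφ) x v s).const_mul v.2
  have h3 := (hasDerivAt_id s).mul (hasDerivAt_comp_curve (contDiff_Dt hφ) x v s)
  have := (h1.add h2).sub h3
  simp only [id, one_mul] at this
  exact this

lemma exists_taylor_two {h h' h'' : ℝ → ℝ} (h1 : ∀ x, HasDerivAt h (h' x) x)
    (h2 : ∀ x, HasDerivAt h' (h'' x) x) {s : ℝ} (hs : 0 < s) :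
    ∃ τ, 0 < τ ∧ τ < s ∧ h s = h 0 + s * h' 0 + s ^ 2 / 2 * h'' τ := by
  set K := (h s - h 0 - s * h' 0) * 2 / s ^ 2 with hK
  have hd : ∀ x, HasDerivAt (fun x => h x + (s - x) * h' x + K * ((s - x) ^ 2 / 2))
      ((s - x) * (h'' x - K)) x := fun x => by
    have e : HasDerivAt (fun x => s - x) (-1) x := by
      simpa using (hasDerivAt_id x).const_sub s
    have := ((h1 x).add (e.mul (h2 x))).add (((e.pow 2).div_const 2).const_mul K)
    refine this.congr_deriv ?_
    simp; ring
  obtain ⟨τ, hτ, h0⟩ := exists_hasDerivAt_eq_zero (f := fun x => h x + (s - x) * h' x +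
    K * ((s - x) ^ 2 / 2)) hs (fun x _ => (hd x).continuousAt.continuousWithinAt)
    (by simp [hK]; field_simp; ring) (fun x _ => hd x)
  refine ⟨τ, hτ.1, hτ.2, ?_⟩
  have : h'' τ = K := by
    rcases mul_eq_zero.1 h0 with h | h
    · linarith [hτ.2]
    · linarith
  rw [this, hK]
  field_simp
  ring

lemma exists_taylor_curve {φ : Heis × ℝ → ℝ} (hφ : ContDiff ℝ (⊤ : ℕ∞) φ) (x : Heis × ℝ)
    (v : ℝ × ℝ) {s : ℝ} (hs : 0 < s) :
    ∃ τ, 0 < τ ∧ τ < s ∧ φ (curve x v s) =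
      φ x + s * curveDeriv φ x v 0 + s ^ 2 / 2 * curveDeriv2 φ x v τ := by
  have := exists_taylor_two (hasDerivAt_comp_curve hφ x v) (hasDerivAt_curveDeriv hφ x v) hs
  simpa only [curve_zero] using this

lemma curveDeriv_zero (φ : Heis × ℝ → ℝ) (p : Heis) (t : ℝ) (v : ℝ × ℝ) :
    curveDeriv φ (p, t) v 0 = (gradH (fun w => φ (w, t)) p).1 * v.1 +
      (gradH (fun w => φ (w, t)) p).2 * v.2 := by
  simp only [curveDeriv, curve_zero, Y1, Y2, gradH]
  ring

lemma curveDeriv2_zero {φ : Heis × ℝ → ℝ} (hφ : ContDiff ℝ (⊤ : ℕ∞) φ) (p : Heis) (t : ℝ)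
    (v : ℝ × ℝ) :
    curveDeriv2 φ (p, t) v 0 =
      quadForm (hessH (fun w => φ (w, t)) p) v - deriv (fun s => φ (p, s)) t := by
  rw [deriv_time hφ (p, t)]
  simp only [curveDeriv2, curveDeriv, curve_zero, quadForm, hessH]
  simp only [Y1, Y2]
  ring

end HorizontalTaylor

section RelaxedLimits

variable {X : Type*} [TopologicalSpace X]

/-- The upper relaxed limit of a sequence of functions. -/
def upperLim (w : ℕ → X → ℝ) (x : X) : ℝ :=
  limsup (fun q : ℕ × X => w q.1 q.2) (atTop ×ˢ 𝓝 x)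

/-- The lower relaxed limit of a sequence of functions. -/
def lowerLim (w : ℕ → X → ℝ) (x : X) : ℝ := -upperLim (fun j y => -w j y) x

variable {w : ℕ → X → ℝ} {M : ℝ}

lemma eventually_lt_of_upperLim_lt (hM : ∀ j x, |w j x| ≤ M) {x : X} {c : ℝ}
    (h : upperLim w x < c) : ∀ᶠ q : ℕ × X in atTop ×ˢ 𝓝 x, w q.1 q.2 < c :=
  eventually_lt_of_limsup_lt h
    ⟨M, by rw [eventually_map]; exact Eventually.of_forall fun q => (abs_le.1 (hM _ _)).2⟩

lemma frequently_lt_of_lt_upperLim (hM : ∀ j x, |w j x| ≤ M) {x : X} {c : ℝ}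
    (h : c < upperLim w x) : ∃ᶠ q : ℕ × X in atTop ×ˢ 𝓝 x, c < w q.1 q.2 :=
  frequently_lt_of_lt_limsup
    (IsBoundedUnder.isCoboundedUnder_le
      ⟨-M, by rw [eventually_map]; exact Eventually.of_forall fun q => (abs_le.1 (hM _ _)).1⟩) h

lemma upperLim_le (hM : ∀ j x, |w j x| ≤ M) {x : X} {c : ℝ}
    (h : ∀ᶠ q : ℕ × X in atTop ×ˢ 𝓝 x, w q.1 q.2 ≤ c) : upperLim w x ≤ c := by
  by_contra! hc
  obtain ⟨q, h1, h2⟩ := ((frequently_lt_of_lt_upperLim hM hc).and_eventually h).exists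
  exact absurd h1 (not_lt.2 h2)

lemma le_upperLim (hM : ∀ j x, |w j x| ≤ M) {x : X} {c : ℝ}
    (h : ∀ᶠ q : ℕ × X in atTop ×ˢ 𝓝 x, c ≤ w q.1 q.2) : c ≤ upperLim w x := by
  by_contra! hc
  obtain ⟨q, h1, h2⟩ := ((eventually_lt_of_upperLim_lt hM hc).and h).exists
  exact absurd h1 (not_lt.2 h2)

lemma eventually_of_eventually_prod {x : X} {P : ℕ × X → Prop} (h : ∀ᶠ q in atTop ×ˢ 𝓝 x, P q) :
    ∀ᶠ y in 𝓝 x, ∀ᶠ q in atTop ×ˢ 𝓝 y, P q := by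
  obtain ⟨pa, ha, pb, hb, hab⟩ := eventually_prod_iff.1 h
  filter_upwards [hb.eventually_nhds] with y hy
  exact eventually_prod_iff.2 ⟨pa, ha, pb, hy, hab⟩

lemma upperSemicontinuous_upperLim (hM : ∀ j x, |w j x| ≤ M) :
    UpperSemicontinuous (upperLim w) := by
  intro x c hc
  obtain ⟨d, hd1, hd2⟩ := exists_between hc
  filter_upwards [eventually_of_eventually_prod (eventually_lt_of_upperLim_lt hM hd1)] with y hy
  exact (upperLim_le hM (hy.mono fun q h => h.le)).trans_lt hd2

lemma lowerSemicontinuous_lowerLim (hM : ∀ j x, |w j x| ≤ M) :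
    LowerSemicontinuous (lowerLim w) := by
  intro x c hc
  have h := upperSemicontinuous_upperLim (w := fun j y => -w j y) (M := M)
    (fun j x => by rw [abs_neg]; exact hM j x) x (-c) (by unfold lowerLim at hc; linarith)
  filter_upwards [h] with y hy
  unfold lowerLim
  linarith

lemma exists_lt_eventually_sub_le (hM : ∀ j x, |w j x| ≤ M) {φ : X → ℝ} (hφ : Continuous φ)
    {S : Set X} (hS : IsCompact S) {m : ℝ} (h : ∀ z ∈ S, upperLim w z - φ z < m) :
    ∃ d < m, ∀ᶠ j in atTop, ∀ z ∈ S, w j z - φ z ≤ d := by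
  refine hS.induction_on (p := fun S => ∃ d < m, ∀ᶠ j in atTop, ∀ z ∈ S, w j z - φ z ≤ d)
    ⟨m - 1, by linarith, by simp⟩ ?_ ?_ ?_
  · rintro s t hst ⟨d, hd, h⟩
    exact ⟨d, hd, h.mono fun j hj z hz => hj z (hst hz)⟩
  · rintro s t ⟨d, hd, h⟩ ⟨d', hd', h'⟩
    refine ⟨max d d', max_lt hd hd', ?_⟩
    filter_upwards [h, h'] with j hj hj' z hz
    rcases hz with hz | hz
    · exact (hj z hz).trans (le_max_left _ _)
    · exact (hj' z hz).trans (le_max_right _ _)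
  · intro z hz
    set l := upperLim w z - φ z with hl
    have hlm := h z hz
    obtain ⟨pa, ha, pb, hb, hab⟩ := eventually_prod_iff.1
      (eventually_lt_of_upperLim_lt hM (show upperLim w z < upperLim w z + (m - l) / 3 by linarith))
    have hφz : ∀ᶠ y in 𝓝 z, φ z - (m - l) / 3 < φ y :=
      (hφ.tendsto z).eventually (lt_mem_nhds (by linarith))
    refine ⟨{y | pb y ∧ φ z - (m - l) / 3 < φ y}, mem_nhdsWithin_of_mem_nhds (hb.and hφz),
      l + 2 * ((m - l) / 3), by linarith, ?_⟩
    filter_upwards [ha] with j hj y hy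
    have h1 := hab hj hy.1
    have h2 := hy.2
    simp only at h1
    linarith

/-- Almost maximum points of `w j - φ` accumulate at strict local maximum points of
`upperLim w - φ`. -/
lemma exists_frequently_almost_max [LocallyCompactSpace X] (hM : ∀ j x, |w j x| ≤ M) {φ : X → ℝ}
    (hφ : Continuous φ) {x : X} {U : Set X} (hU : U ∈ 𝓝 x)
    (hmax : ∀ q ∈ U, q ≠ x → upperLim w q - φ q < upperLim w x - φ x)
    {e : ℕ → ℝ} (he : ∀ j, 0 < e j) :
    ∃ B ∈ 𝓝 x, ∃ᶠ q : ℕ × X in atTop ×ˢ 𝓝 x, ∀ z ∈ B,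
      w q.1 z - φ z ≤ w q.1 q.2 - φ q.2 + e q.1 := by
  obtain ⟨B, hB, hBU, hBc⟩ := local_compact_nhds hU
  refine ⟨B, hB, fun hcon => ?_⟩
  obtain ⟨pa, ha, pb, hb, hab⟩ := eventually_prod_iff.1 hcon
  set m := upperLim w x - φ x with hm
  have hb' : {y | pb y} ∈ 𝓝 x := hb
  obtain ⟨d, hdm, hd⟩ := exists_lt_eventually_sub_le hM hφ (m := m)
    (hBc.diff (isOpen_interior (s := {y | pb y}))) (fun z hz => hmax z (hBU hz.1) (by
      rintro rfl
      exact hz.2 (mem_interior_iff_mem_nhds.2 hb')))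
  obtain ⟨d', hdd', hd'm⟩ := exists_between hdm
  have hφx : ∀ᶠ q : ℕ × X in atTop ×ˢ 𝓝 x, φ q.2 < φ x + (m - d') / 2 :=
    tendsto_snd.eventually ((hφ.tendsto x).eventually (gt_mem_nhds (by linarith)))
  have hfr := frequently_lt_of_lt_upperLim hM
    (show upperLim w x - (m - d') / 2 < upperLim w x by linarith)
  have hev : ∀ᶠ q : ℕ × X in atTop ×ˢ 𝓝 x, (pa q.1 ∧ (∀ z ∈ B \ interior {y | pb y},
      w q.1 z - φ z ≤ d)) ∧ q.2 ∈ B := (ha.and hd).prod_mk hB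
  obtain ⟨⟨j, y⟩, h1, h2, ⟨h3, h4⟩, h5⟩ := (hfr.and_eventually (hφx.and hev)).exists
  simp only at h1 h2 h3 h4 h5
  obtain ⟨b, hbφ⟩ := (hBc.image_of_continuousOn hφ.continuousOn).bddBelow
  have hbdd : BddAbove ((fun z => w j z - φ z) '' B) := by
    refine ⟨M - b, ?_⟩
    rintro _ ⟨z, hz, rfl⟩
    have := hbφ ⟨z, hz, rfl⟩
    have := (abs_le.1 (hM j z)).2
    simp only
    linarith
  have hε : 0 < min (e j) (d' - d) := lt_min (he j) (by linarith)
  obtain ⟨_, ⟨y', hy', rfl⟩, hlt⟩ := exists_lt_of_lt_csSup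
    (Set.Nonempty.image (fun z => w j z - φ z) ⟨y, h5⟩) (sub_lt_self _ hε)
  have hle : ∀ z ∈ B, w j z - φ z ≤ sSup ((fun z => w j z - φ z) '' B) :=
    fun z hz => le_csSup hbdd ⟨z, hz, rfl⟩
  have hy'V : pb y' := by
    by_contra hn
    have := h4 y' ⟨hy', fun h => hn (interior_subset (s := {y | pb y}) h)⟩
    have := hle y h5
    have := min_le_right (e j) (d' - d)
    simp only at hlt
    linarith
  refine hab h3 hy'V fun z hz => ?_
  have := hle z hz
  have := min_le_left (e j) (d' - d)
  simp only at hlt ⊢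
  linarith

lemma upperLim_le_of_le (hM : ∀ j x, |w j x| ≤ M) {g : X → ℝ} {x : X} (hg : ContinuousAt g x)
    (h : ∀ j y, w j y ≤ g y) : upperLim w x ≤ g x := by
  refine le_of_forall_pos_le_add fun η hη => upperLim_le hM ?_
  have hev : ∀ᶠ q : ℕ × X in atTop ×ˢ 𝓝 x, g q.2 < g x + η :=
    tendsto_snd.eventually (hg.eventually (gt_mem_nhds (lt_add_of_pos_right _ hη)))
  exact hev.mono fun q hq => (h q.1 q.2).trans hq.le

lemma le_upperLim_of_le (hM : ∀ j x, |w j x| ≤ M) {g : X → ℝ} {x : X} (hg : ContinuousAt g x)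
    (h : ∀ j y, g y ≤ w j y) : g x ≤ upperLim w x := by
  refine le_of_forall_sub_le fun η hη => le_upperLim hM ?_
  have hev : ∀ᶠ q : ℕ × X in atTop ×ˢ 𝓝 x, g x - η < g q.2 :=
    tendsto_snd.eventually (hg.eventually (lt_mem_nhds (sub_lt_self _ hη)))
  exact hev.mono fun q hq => hq.le.trans (h q.1 q.2)

lemma le_lowerLim_of_le (hM : ∀ j x, |w j x| ≤ M) {g : X → ℝ} {x : X} (hg : ContinuousAt g x)
    (h : ∀ j y, g y ≤ w j y) : g x ≤ lowerLim w x :=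
  le_neg.2 (upperLim_le_of_le (w := fun j y => -w j y) (M := M)
    (fun j x => by rw [abs_neg]; exact hM j x) hg.neg fun j y => neg_le_neg (h j y))

lemma lowerLim_le_of_le (hM : ∀ j x, |w j x| ≤ M) {g : X → ℝ} {x : X} (hg : ContinuousAt g x)
    (h : ∀ j y, w j y ≤ g y) : lowerLim w x ≤ g x :=
  neg_le.2 (le_upperLim_of_le (w := fun j y => -w j y) (M := M)
    (fun j x => by rw [abs_neg]; exact hM j x) hg.neg fun j y => neg_le_neg (h j y))

end RelaxedLimits

section Consistency

lemma exists_unit_perp (ξ : ℝ × ℝ) :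
    ∃ v : ℝ × ℝ, v.1 ^ 2 + v.2 ^ 2 = 1 ∧ ξ.1 * v.1 + ξ.2 * v.2 = 0 := by
  by_cases h : ξ.1 ^ 2 + ξ.2 ^ 2 = 0
  · have h1 : ξ.1 = 0 := by nlinarith [sq_nonneg ξ.1, sq_nonneg ξ.2]
    have h2 : ξ.2 = 0 := by nlinarith [sq_nonneg ξ.1, sq_nonneg ξ.2]
    exact ⟨(1, 0), by simp, by simp [h1, h2]⟩
  · have hr : √(ξ.1 ^ 2 + ξ.2 ^ 2) ≠ 0 := by
      rw [Real.sqrt_ne_zero (by positivity)]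
      exact h
    refine ⟨(-ξ.2 / √(ξ.1 ^ 2 + ξ.2 ^ 2), ξ.1 / √(ξ.1 ^ 2 + ξ.2 ^ 2)), ?_, ?_⟩
    · simp only [div_pow, Real.sq_sqrt (show 0 ≤ ξ.1 ^ 2 + ξ.2 ^ 2 by positivity)]
      field_simp
      ring
    · field_simp
      ring

lemma isCompact_unit : IsCompact {v : ℝ × ℝ | v.1 ^ 2 + v.2 ^ 2 = 1} := by
  refine Metric.isCompact_of_isClosed_isBounded
    (isClosed_eq (by fun_prop) continuous_const) ?_
  refine (Metric.isBounded_closedBall (x := (0 : ℝ × ℝ)) (r := 1)).subset fun v hv => ?_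
  have hv : v.1 ^ 2 + v.2 ^ 2 = 1 := hv
  rw [mem_closedBall_zero_iff, Prod.norm_def]
  exact max_le (abs_le_one_iff_mul_self_le_one.2 (by nlinarith [sq_nonneg v.2]))
    (abs_le_one_iff_mul_self_le_one.2 (by nlinarith [sq_nonneg v.1]))

lemma curveDeriv_neg_zero (φ : Heis × ℝ → ℝ) (x : Heis × ℝ) (v : ℝ × ℝ) :
    curveDeriv φ x (-v) 0 = -curveDeriv φ x v 0 := by
  rw [curveDeriv_zero φ x.1 x.2, curveDeriv_zero φ x.1 x.2]
  simp only [Prod.fst_neg, Prod.snd_neg]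
  ring

lemma curveDeriv2_neg_zero {φ : Heis × ℝ → ℝ} (hφ : ContDiff ℝ (⊤ : ℕ∞) φ) (x : Heis × ℝ)
    (v : ℝ × ℝ) : curveDeriv2 φ x (-v) 0 = curveDeriv2 φ x v 0 := by
  rw [curveDeriv2_zero hφ x.1 x.2, curveDeriv2_zero hφ x.1 x.2]
  simp only [quadForm, Prod.fst_neg, Prod.snd_neg]
  ring

lemma tendsto_curve {y : ℕ → Heis × ℝ} {v : ℕ → ℝ × ℝ} {s : ℕ → ℝ} {x : Heis × ℝ} {v₀ : ℝ × ℝ}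
    (hy : Tendsto y atTop (𝓝 x)) (hv : Tendsto v atTop (𝓝 v₀)) (hs : Tendsto s atTop (𝓝 0)) :
    Tendsto (fun k => curve (y k) (v k) (s k)) atTop (𝓝 x) := by
  have := (continuous_curve.tendsto (x, v₀, 0)).comp (hy.prodMk_nhds (hv.prodMk_nhds hs))
  simpa only [curve_zero, Function.comp_def] using this

/-- Second order expansion along the curves `curve (y k) (v k)` when `y k → x`, `v k → v₀` and
`s k → 0`. -/
lemma exists_tendsto_taylor {φ : Heis × ℝ → ℝ} (hφ : ContDiff ℝ (⊤ : ℕ∞) φ)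
    {y : ℕ → Heis × ℝ} {v : ℕ → ℝ × ℝ} {s : ℕ → ℝ} {x : Heis × ℝ} {v₀ : ℝ × ℝ}
    (hy : Tendsto y atTop (𝓝 x)) (hv : Tendsto v atTop (𝓝 v₀)) (hs : Tendsto s atTop (𝓝 0))
    (hs0 : ∀ k, 0 < s k) :
    ∃ c : ℕ → ℝ, Tendsto c atTop (𝓝 (curveDeriv2 φ x v₀ 0)) ∧
      ∀ k, φ (curve (y k) (v k) (s k)) =
        φ (y k) + s k * curveDeriv φ (y k) (v k) 0 + s k ^ 2 / 2 * c k := by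
  choose τ h0 h1 h2 using fun k => exists_taylor_curve hφ (y k) (v k) (hs0 k)
  have hτ : Tendsto τ atTop (𝓝 0) :=
    squeeze_zero (fun k => (h0 k).le) (fun k => (h1 k).le) hs
  exact ⟨fun k => curveDeriv2 φ (y k) (v k) (τ k),
    ((continuous_curveDeriv2 hφ).tendsto (x, v₀, 0)).comp (hy.prodMk_nhds (hv.prodMk_nhds hτ)), h2⟩

variable {w : ℕ → Heis × ℝ → ℝ} {M : ℝ} {s : ℕ → ℝ}

lemma eventually_sq_le {y : ℕ → Heis × ℝ} {s : ℕ → ℝ} {p : Heis} {t : ℝ} (ht : 0 < t)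
    (hy : Tendsto y atTop (𝓝 (p, t))) (hs : Tendsto s atTop (𝓝 0)) :
    ∀ᶠ k in atTop, s k ^ 2 / 2 ≤ (y k).2 := by
  have h1 : Tendsto (fun k => (y k).2) atTop (𝓝 t) := (continuous_snd.tendsto (p, t)).comp hy
  have h2 : Tendsto (fun k => s k ^ 2 / 2) atTop (𝓝 0) := by
    simpa using (hs.pow 2).div_const 2
  filter_upwards [h1.eventually (lt_mem_nhds (half_lt_self ht)),
    h2.eventually (gt_mem_nhds (half_pos ht))] with k hk1 hk2
  linarith

/-- The upper relaxed limit of a discrete scheme is a viscosity subsolution. -/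
lemma flowSubsolution_upperLim (hM : ∀ j x, |w j x| ≤ M) (hs0 : ∀ j, 0 < s j)
    (hs : Tendsto s atTop (𝓝 0))
    (hw : ∀ j x v, v.1 ^ 2 + v.2 ^ 2 = 1 → s j ^ 2 / 2 ≤ x.2 →
      w j x ≤ max (w j (curve x v (s j))) (w j (curve x (-v) (s j)))) :
    FlowSubsolution (upperLim w) := by
  intro φ hφ p t ht ⟨U, hU, hmax⟩
  have hpos : {q : Heis × ℝ | 0 < q.2} ∈ 𝓝 ((p, t) : Heis × ℝ) :=
    (isOpen_lt continuous_const continuous_snd).mem_nhds ht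
  obtain ⟨B, hB, hfr⟩ := exists_frequently_almost_max hM hφ.continuous (inter_mem hU hpos)
    (fun q hq hne => hmax q hq.1 hq.2 hne) (e := fun j => s j ^ 3) (fun j => pow_pos (hs0 j) 3)
  obtain ⟨q, hq, hqB⟩ := exists_seq_forall_of_frequently hfr
  choose v hv1 hv2 using fun k => exists_unit_perp (Y1 φ (q k).2, Y2 φ (q k).2)
  obtain ⟨v₀, hv₀, θ, hθ, hvθ⟩ := isCompact_unit.tendsto_subseq hv1
  have hj : Tendsto (fun k => (q (θ k)).1) atTop atTop :=
    (tendsto_fst.comp hq).comp hθ.tendsto_atTop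
  have hy : Tendsto (fun k => (q (θ k)).2) atTop (𝓝 (p, t)) :=
    (tendsto_snd.comp hq).comp hθ.tendsto_atTop
  have hsk : Tendsto (fun k => s (q (θ k)).1) atTop (𝓝 0) := hs.comp hj
  have hvn : Tendsto (fun k => -v (θ k)) atTop (𝓝 (-v₀)) := hvθ.neg
  obtain ⟨c, hc, hcT⟩ := exists_tendsto_taylor hφ hy hvθ hsk (fun k => hs0 _)
  obtain ⟨c', hc', hcT'⟩ := exists_tendsto_taylor hφ hy hvn hsk (fun k => hs0 _)
  have hzero : ∀ k, curveDeriv φ (q (θ k)).2 (v (θ k)) 0 = 0 := fun k => by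
    rw [curveDeriv_zero φ (q (θ k)).2.1 (q (θ k)).2.2]
    exact hv2 (θ k)
  have hperp : curveDeriv φ (p, t) v₀ 0 = 0 := by
    have := ((continuous_curveDeriv hφ).tendsto ((p, t), v₀, 0)).comp
      (hy.prodMk_nhds (hvθ.prodMk_nhds tendsto_const_nhds))
    refine tendsto_nhds_unique this (tendsto_const_nhds.congr fun k => ?_)
    exact (hzero k).symm
  have hmaxc : 0 ≤ max (curveDeriv2 φ (p, t) v₀ 0) (curveDeriv2 φ (p, t) (-v₀) 0) := by
    have hlim : Tendsto (fun k => -2 * s (q (θ k)).1) atTop (𝓝 0) := by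
      simpa using hsk.const_mul (-2)
    refine le_of_tendsto_of_tendsto hlim (hc.max hc') ?_
    filter_upwards [(tendsto_curve hy hvθ hsk).eventually hB,
      (tendsto_curve hy hvn hsk).eventually hB, eventually_sq_le ht hy hsk] with k h1 h2 h3
    have hs2 : 0 < s (q (θ k)).1 ^ 2 := pow_pos (hs0 _) 2
    have e1 := hqB (θ k) _ h1
    have e2 := hqB (θ k) _ h2
    have t1 := hcT k
    have t2 := hcT' k
    rw [curveDeriv_neg_zero] at t2
    simp only [Function.comp_apply] at t1 e1
    rw [hzero] at t1 t2
    rcases le_max_iff.1 (hw (q (θ k)).1 (q (θ k)).2 (v (θ k)) (hv1 _) h3) with h | h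
    · exact le_max_of_le_left (by nlinarith)
    · exact le_max_of_le_right (by nlinarith)
  rw [curveDeriv2_neg_zero hφ, max_self, curveDeriv2_zero hφ] at hmaxc
  rw [curveDeriv_zero] at hperp
  have := FcurvLower_le (hessH (fun w => φ (w, t)) p) hv₀ hperp
  linarith

/-- The lower relaxed limit of a discrete scheme is a viscosity supersolution. -/
lemma flowSupersolution_lowerLim (hM : ∀ j x, |w j x| ≤ M) (hs0 : ∀ j, 0 < s j)
    (hs : Tendsto s atTop (𝓝 0))
    (hw : ∀ j x, s j ^ 2 / 2 ≤ x.2 → ∃ v : ℝ × ℝ, v.1 ^ 2 + v.2 ^ 2 = 1 ∧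
      max (w j (curve x v (s j))) (w j (curve x (-v) (s j))) ≤ w j x + s j ^ 3) :
    FlowSupersolution (lowerLim w) := by
  intro φ hφ p t ht ⟨U, hU, hmax⟩
  have hpos : {q : Heis × ℝ | 0 < q.2} ∈ 𝓝 ((p, t) : Heis × ℝ) :=
    (isOpen_lt continuous_const continuous_snd).mem_nhds ht
  obtain ⟨B, hB, hfr⟩ := exists_frequently_almost_max (w := fun j y => -w j y) (M := M)
    (fun j x => by rw [abs_neg]; exact hM j x) (φ := fun x => -φ x) hφ.continuous.neg
    (inter_mem hU hpos) (fun q hq hne => by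
      have := hmax q hq.1 hq.2 hne
      unfold lowerLim at this
      linarith) (e := fun j => s j ^ 3) (fun j => pow_pos (hs0 j) 3)
  obtain ⟨q, hq, hqB⟩ := exists_seq_forall_of_frequently hfr
  have hex : ∀ k, ∃ v : ℝ × ℝ, v.1 ^ 2 + v.2 ^ 2 = 1 ∧ (s (q k).1 ^ 2 / 2 ≤ (q k).2.2 →
      max (w (q k).1 (curve (q k).2 v (s (q k).1))) (w (q k).1 (curve (q k).2 (-v) (s (q k).1)))
        ≤ w (q k).1 (q k).2 + s (q k).1 ^ 3) := fun k => by
    by_cases h : s (q k).1 ^ 2 / 2 ≤ (q k).2.2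
    · obtain ⟨v, h1, h2⟩ := hw _ _ h
      exact ⟨v, h1, fun _ => h2⟩
    · exact ⟨(1, 0), by simp, fun h' => absurd h' h⟩
  choose v hv1 hv2 using hex
  obtain ⟨v₀, hv₀, θ, hθ, hvθ⟩ := isCompact_unit.tendsto_subseq hv1
  have hj : Tendsto (fun k => (q (θ k)).1) atTop atTop :=
    (tendsto_fst.comp hq).comp hθ.tendsto_atTop
  have hy : Tendsto (fun k => (q (θ k)).2) atTop (𝓝 (p, t)) :=
    (tendsto_snd.comp hq).comp hθ.tendsto_atTop
  have hsk : Tendsto (fun k => s (q (θ k)).1) atTop (𝓝 0) := hs.comp hj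
  have hvn : Tendsto (fun k => -v (θ k)) atTop (𝓝 (-v₀)) := hvθ.neg
  obtain ⟨c, hc, hcT⟩ := exists_tendsto_taylor hφ hy hvθ hsk (fun k => hs0 _)
  obtain ⟨c', hc', hcT'⟩ := exists_tendsto_taylor hφ hy hvn hsk (fun k => hs0 _)
  have hD : Tendsto (fun k => curveDeriv φ (q (θ k)).2 (v (θ k)) 0) atTop
      (𝓝 (curveDeriv φ (p, t) v₀ 0)) :=
    ((continuous_curveDeriv hφ).tendsto ((p, t), v₀, 0)).comp
      (hy.prodMk_nhds (hvθ.prodMk_nhds tendsto_const_nhds))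
  have hineq : ∀ᶠ k in atTop,
      curveDeriv φ (q (θ k)).2 (v (θ k)) 0 + s (q (θ k)).1 / 2 * c k ≤ 2 * s (q (θ k)).1 ^ 2 ∧
      -curveDeriv φ (q (θ k)).2 (v (θ k)) 0 + s (q (θ k)).1 / 2 * c' k ≤
        2 * s (q (θ k)).1 ^ 2 := by
    filter_upwards [(tendsto_curve hy hvθ hsk).eventually hB,
      (tendsto_curve hy hvn hsk).eventually hB, eventually_sq_le ht hy hsk] with k h1 h2 h3
    have hs1 := hs0 (q (θ k)).1
    have e1 := hqB (θ k) _ h1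
    have e2 := hqB (θ k) _ h2
    have t1 := hcT k
    have t2 := hcT' k
    rw [curveDeriv_neg_zero] at t2
    simp only [Function.comp_apply] at t1 e1
    obtain ⟨m1, m2⟩ := max_le_iff.1 (hv2 (θ k) h3)
    constructor
    · refine le_of_mul_le_mul_left ?_ hs1
      nlinarith
    · refine le_of_mul_le_mul_left ?_ hs1
      nlinarith
  have hs2 : Tendsto (fun k => 2 * s (q (θ k)).1 ^ 2) atTop (𝓝 0) := by
    simpa using (hsk.pow 2).const_mul 2
  have hperp : curveDeriv φ (p, t) v₀ 0 = 0 := by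
    have l1 : Tendsto (fun k => curveDeriv φ (q (θ k)).2 (v (θ k)) 0 + s (q (θ k)).1 / 2 * c k)
        atTop (𝓝 (curveDeriv φ (p, t) v₀ 0)) := by
      simpa using hD.add ((hsk.div_const 2).mul hc)
    have l2 : Tendsto (fun k => -curveDeriv φ (q (θ k)).2 (v (θ k)) 0 + s (q (θ k)).1 / 2 * c' k)
        atTop (𝓝 (-curveDeriv φ (p, t) v₀ 0)) := by
      simpa using hD.neg.add ((hsk.div_const 2).mul hc')
    have := le_of_tendsto_of_tendsto l1 hs2 (hineq.mono fun k h => h.1)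
    have := le_of_tendsto_of_tendsto l2 hs2 (hineq.mono fun k h => h.2)
    linarith
  have hsum : curveDeriv2 φ (p, t) v₀ 0 + curveDeriv2 φ (p, t) (-v₀) 0 ≤ 0 := by
    have hlim : Tendsto (fun k => 8 * s (q (θ k)).1) atTop (𝓝 0) := by
      simpa using hsk.const_mul 8
    refine le_of_tendsto_of_tendsto (hc.add hc') hlim ?_
    filter_upwards [hineq] with k hk
    refine le_of_mul_le_mul_left ?_ (hs0 (q (θ k)).1)
    nlinarith [hk.1, hk.2]
  rw [curveDeriv2_neg_zero hφ, curveDeriv2_zero hφ] at hsum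
  rw [curveDeriv_zero] at hperp
  have := le_FcurvUpper (hessH (fun w => φ (w, t)) p) hv₀ hperp
  linarith

end Consistency

section Game

/-- One step of the game with step size `s`. -/
def gameStep (s : ℝ) (f : Heis → ℝ) (p : Heis) : ℝ :=
  ⨅ v : {v : ℝ × ℝ // v.1 ^ 2 + v.2 ^ 2 = 1},
    max (f (move p (s • v.1))) (f (move p (s • -v.1)))

/-- Uniform quasiconvexity along horizontal segments of length `2s` with gap `κ`. -/
def MidStrict (s κ : ℝ) (f : Heis → ℝ) : Prop :=
  ∀ p : Heis, ∀ v : ℝ × ℝ, v.1 ^ 2 + v.2 ^ 2 = 1 →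
    f p + κ ≤ max (f (move p (s • v))) (f (move p (s • -v)))

/-- The truncated value of the game with step size `s` and terminal cost `f`. -/
def gameValue (s C : ℝ) (f : Heis → ℝ) (x : Heis × ℝ) : ℝ :=
  min ((gameStep s)^[⌊2 * x.2 / s ^ 2⌋₊] f x.1) C

variable {s κ C : ℝ} {f : Heis → ℝ}

instance : Nonempty {v : ℝ × ℝ // v.1 ^ 2 + v.2 ^ 2 = 1} := ⟨⟨(1, 0), by simp⟩⟩

lemma MidStrict.add_le_gameStep (hf : MidStrict s κ f) (p : Heis) : f p + κ ≤ gameStep s f p :=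
  le_ciInf fun v => hf p v.1 v.2

lemma MidStrict.gameStep_le (hf : MidStrict s κ f) (p : Heis) {v : ℝ × ℝ}
    (hv : v.1 ^ 2 + v.2 ^ 2 = 1) :
    gameStep s f p ≤ max (f (move p (s • v))) (f (move p (s • -v))) :=
  ciInf_le (f := fun v : {v : ℝ × ℝ // v.1 ^ 2 + v.2 ^ 2 = 1} =>
    max (f (move p (s • v.1))) (f (move p (s • -v.1))))
    ⟨f p + κ, by rintro _ ⟨v, rfl⟩; exact hf p v.1 v.2⟩ ⟨v, hv⟩

lemma exists_max_le_gameStep_add (s : ℝ) (f : Heis → ℝ) (p : Heis) {δ : ℝ} (hδ : 0 < δ) :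
    ∃ v : ℝ × ℝ, v.1 ^ 2 + v.2 ^ 2 = 1 ∧
      max (f (move p (s • v))) (f (move p (s • -v))) ≤ gameStep s f p + δ := by
  obtain ⟨v, hv⟩ := exists_lt_of_ciInf_lt (lt_add_of_pos_right (gameStep s f p) hδ)
  exact ⟨v.1, v.2, hv.le⟩

lemma MidStrict.step (hf : MidStrict s κ f) : MidStrict s κ (gameStep s f) := fun p v hv =>
  calc gameStep s f p + κ
      ≤ max (f (move p (s • v))) (f (move p (s • -v))) + κ := by
        gcongr
        exact hf.gameStep_le p hv
    _ = max (f (move p (s • v)) + κ) (f (move p (s • -v)) + κ) := (max_add_add_right _ _ _).symm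
    _ ≤ _ := max_le_max (hf.add_le_gameStep _) (hf.add_le_gameStep _)

lemma MidStrict.iterate (hf : MidStrict s κ f) (n : ℕ) : MidStrict s κ ((gameStep s)^[n] f) := by
  induction n with
  | zero => exact hf
  | succ n ih => rw [Function.iterate_succ_apply']; exact ih.step

lemma MidStrict.le_iterate (hf : MidStrict s κ f) (hκ : 0 ≤ κ) (n : ℕ) (p : Heis) :
    f p ≤ (gameStep s)^[n] f p := by
  induction n with
  | zero => exact le_rfl
  | succ n ih =>
    rw [Function.iterate_succ_apply']
    linarith [(hf.iterate n).add_le_gameStep p]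

lemma min_le_max_min {a b c : ℝ} (h : c ≤ max a b) : min c C ≤ max (min a C) (min b C) := by
  rcases le_max_iff.1 h with h | h
  · exact le_max_of_le_left (min_le_min_right C h)
  · exact le_max_of_le_right (min_le_min_right C h)

lemma floor_step (hs : 0 < s) {t : ℝ} (ht : s ^ 2 / 2 ≤ t) :
    ⌊2 * t / s ^ 2⌋₊ = ⌊2 * (t - s ^ 2 / 2) / s ^ 2⌋₊ + 1 := by
  have h : 2 * t / s ^ 2 = 2 * (t - s ^ 2 / 2) / s ^ 2 + 1 := by
    field_simp
    ring
  rw [h, Nat.floor_add_one]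
  exact div_nonneg (by linarith) (by positivity)

lemma gameValue_le (hf : MidStrict s κ f) (hs : 0 < s) {x : Heis × ℝ} (hx : s ^ 2 / 2 ≤ x.2)
    {v : ℝ × ℝ} (hv : v.1 ^ 2 + v.2 ^ 2 = 1) :
    gameValue s C f x ≤ max (gameValue s C f (curve x v s)) (gameValue s C f (curve x (-v) s)) := by
  simp only [gameValue, curve, floor_step hs hx, Function.iterate_succ_apply']
  exact min_le_max_min ((hf.iterate _).gameStep_le x.1 hv)

lemma exists_max_le_gameValue_add (hs : 0 < s) {x : Heis × ℝ} (hx : s ^ 2 / 2 ≤ x.2)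
    {δ : ℝ} (hδ : 0 < δ) : ∃ v : ℝ × ℝ, v.1 ^ 2 + v.2 ^ 2 = 1 ∧
      max (gameValue s C f (curve x v s)) (gameValue s C f (curve x (-v) s)) ≤
        gameValue s C f x + δ := by
  simp only [gameValue, curve, floor_step hs hx, Function.iterate_succ_apply']
  obtain ⟨v, hv, h⟩ := exists_max_le_gameStep_add s
    ((gameStep s)^[⌊2 * (x.2 - s ^ 2 / 2) / s ^ 2⌋₊] f) x.1 hδ
  obtain ⟨h1, h2⟩ := max_le_iff.1 h
  refine ⟨v, hv, ?_⟩
  rw [← min_add_add_right]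
  exact max_le (min_le_min h1 (by linarith)) (min_le_min h2 (by linarith))

lemma le_max_of_lt_max_adjacent {a : ℕ → ℝ} (ha : ∀ i, a (i + 1) < max (a i) (a (i + 2)))
    {k N : ℕ} (hk : k ≤ N) : a k ≤ max (a 0) (a N) := by
  obtain ⟨m, hm, hmax⟩ := Finset.exists_max_image (Finset.range (N + 1)) a ⟨0, by simp⟩
  have hmN : m ≤ N := Nat.lt_succ_iff.1 (Finset.mem_range.1 hm)
  refine (hmax k (Finset.mem_range.2 (Nat.lt_succ_iff.2 hk))).trans ?_
  rcases Nat.eq_zero_or_pos m with rfl | h0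
  · exact le_max_left _ _
  rcases hmN.eq_or_lt with rfl | hlt
  · exact le_max_right _ _
  obtain ⟨i, rfl⟩ := Nat.exists_eq_succ_of_ne_zero h0.ne'
  have h1 := hmax i (Finset.mem_range.2 (by omega))
  have h2 := hmax (i + 2) (Finset.mem_range.2 (by omega))
  exact absurd (ha i) (not_lt.2 (max_le h1 h2))

lemma move_move_smul (p : Heis) (v : ℝ × ℝ) (a b : ℝ) :
    move (move p (a • v)) (b • v) = move p ((a + b) • v) := by
  ext <;> simp only [move, Prod.smul_fst, Prod.smul_snd, smul_eq_mul] <;> ring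

lemma gameValue_progression_le (hf : MidStrict s κ f) (hκ : 0 < κ) (p : Heis) {v : ℝ × ℝ}
    (hv : v.1 ^ 2 + v.2 ^ 2 = 1) (t : ℝ) {k N : ℕ} (hk : k ≤ N) :
    gameValue s C f (move p ((k * s) • v), t) ≤
      max (gameValue s C f (p, t)) (gameValue s C f (move p ((N * s) • v), t)) := by
  have hg := hf.iterate ⌊2 * t / s ^ 2⌋₊
  refine min_le_max_min ?_
  have key := le_max_of_lt_max_adjacent
    (a := fun i : ℕ => (gameStep s)^[⌊2 * t / s ^ 2⌋₊] f (move p ((i * s) • v))) (fun i => ?_) hk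
  · simpa [move] using key
  have h := hg (move p (((i + 1 : ℕ) * s) • v)) v hv
  rw [smul_neg, ← neg_smul, move_move_smul, move_move_smul, max_comm] at h
  have e1 : ((i + 1 : ℕ) : ℝ) * s + -s = i * s := by push_cast; ring
  have e2 : ((i + 1 : ℕ) : ℝ) * s + s = (i + 2 : ℕ) * s := by push_cast; ring
  rw [e1, e2] at h
  exact lt_of_lt_of_le (lt_add_of_pos_right _ hκ) h

end Game

section Barrier

/-- The left translate by `p₀⁻¹`. -/
def relPos (p₀ p : Heis) : Heis :=
  (p.1 - p₀.1, p.2.1 - p₀.2.1, p.2.2 - p₀.2.2 - (p₀.1 * p.2.1 - p.1 * p₀.2.1) / 2)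

/-- The squared Euclidean length of `p₀⁻¹ · p`. -/
def barrier (p₀ p : Heis) : ℝ :=
  (relPos p₀ p).1 ^ 2 + (relPos p₀ p).2.1 ^ 2 + (relPos p₀ p).2.2 ^ 2

lemma exists_barrier_move_le (p₀ p : Heis) (s : ℝ) : ∃ v : ℝ × ℝ, v.1 ^ 2 + v.2 ^ 2 = 1 ∧
    barrier p₀ (move p (s • v)) + 4 ≤ (1 + s ^ 2 / 4) * (barrier p₀ p + 4) ∧
    barrier p₀ (move p (s • -v)) + 4 ≤ (1 + s ^ 2 / 4) * (barrier p₀ p + 4) := by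
  set d := relPos p₀ p with hd
  have hmove : ∀ w : ℝ × ℝ, barrier p₀ (move p w) =
      (d.1 + w.1) ^ 2 + (d.2.1 + w.2) ^ 2 + (d.2.2 + (d.1 * w.2 - w.1 * d.2.1) / 2) ^ 2 := fun w => by
    simp only [hd, barrier, relPos, move]
    ring
  obtain ⟨v, hv, hperp⟩ := exists_unit_perp
    (d.1 - d.2.2 * d.2.1 / 2, d.2.1 + d.2.2 * d.1 / 2)
  simp only at hperp
  have hb : barrier p₀ p = d.1 ^ 2 + d.2.1 ^ 2 + d.2.2 ^ 2 := rfl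
  have hcs : (d.1 * v.2 - v.1 * d.2.1) ^ 2 ≤ barrier p₀ p := by
    have : (d.1 * v.2 - v.1 * d.2.1) ^ 2 + (d.1 * v.1 + d.2.1 * v.2) ^ 2 = d.1 ^ 2 + d.2.1 ^ 2 := by
      linear_combination (d.1 ^ 2 + d.2.1 ^ 2) * hv
    nlinarith [sq_nonneg (d.1 * v.1 + d.2.1 * v.2), sq_nonneg d.2.2]
  have hs : s ^ 2 / 4 * (d.1 * v.2 - v.1 * d.2.1) ^ 2 ≤ s ^ 2 / 4 * barrier p₀ p := by gcongr
  have hp : barrier p₀ (move p (s • v)) =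
      barrier p₀ p + s ^ 2 + s ^ 2 / 4 * (d.1 * v.2 - v.1 * d.2.1) ^ 2 := by
    rw [hmove, hb]
    simp only [Prod.smul_fst, Prod.smul_snd, smul_eq_mul]
    linear_combination 2 * s * hperp + s ^ 2 * hv
  have hm : barrier p₀ (move p (s • -v)) =
      barrier p₀ p + s ^ 2 + s ^ 2 / 4 * (d.1 * v.2 - v.1 * d.2.1) ^ 2 := by
    rw [hmove, hb]
    simp only [Prod.smul_fst, Prod.smul_snd, smul_eq_mul, Prod.fst_neg, Prod.snd_neg]
    linear_combination -2 * s * hperp + s ^ 2 * hv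
  refine ⟨v, hv, ?_, ?_⟩
  · rw [hp]; linarith
  · rw [hm]; linarith

lemma continuous_barrier (p₀ : Heis) : Continuous (barrier p₀) := by
  unfold barrier relPos
  fun_prop

lemma barrier_self (p₀ : Heis) : barrier p₀ p₀ = 0 := by
  simp [barrier, relPos]

lemma barrier_nonneg (p₀ p : Heis) : 0 ≤ barrier p₀ p := by
  unfold barrier
  positivity

lemma exists_le_add_mul_barrier {g : Heis → ℝ} {C : ℝ} (hg : Continuous g) (hC : ∀ p, g p ≤ C)
    (p₀ : Heis) {η : ℝ} (hη : 0 < η) :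
    ∃ N, 0 ≤ N ∧ ∀ p, g p ≤ g p₀ + η + N * barrier p₀ p := by
  have hc : Continuous fun d : Heis => g (hMul p₀ d) := by
    unfold hMul
    fun_prop
  have h0 : g (hMul p₀ 0) < g p₀ + η := by
    simpa [hMul] using hη
  obtain ⟨ε, hε, hball⟩ := Metric.eventually_nhds_iff.1
    ((hc.tendsto 0).eventually (gt_mem_nhds h0))
  have hpos : 0 ≤ C - g p₀ := sub_nonneg.2 (hC p₀)
  refine ⟨(C - g p₀) / ε ^ 2, by positivity, fun p => ?_⟩
  have hrel : hMul p₀ (relPos p₀ p) = p := by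
    ext <;> simp only [hMul, relPos] <;> ring
  rcases lt_or_ge (dist (relPos p₀ p) 0) ε with h | h
  · have h1 := hball h
    rw [hrel] at h1
    have := barrier_nonneg p₀ p
    have : 0 ≤ (C - g p₀) / ε ^ 2 * barrier p₀ p := by positivity
    linarith
  · have hb : ε ^ 2 ≤ barrier p₀ p := by
      rw [dist_zero_right, Prod.norm_def, Prod.norm_def, le_max_iff, le_max_iff,
        Real.norm_eq_abs, Real.norm_eq_abs, Real.norm_eq_abs] at h
      unfold barrier
      have hsq : ∀ a : ℝ, ε ≤ |a| → ε ^ 2 ≤ a ^ 2 := fun a ha => by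
        rw [← sq_abs a]
        gcongr
      have e1 := sq_nonneg (relPos p₀ p).1
      have e2 := sq_nonneg (relPos p₀ p).2.1
      have e3 := sq_nonneg (relPos p₀ p).2.2
      rcases h with h | h | h <;> linarith [hsq _ h]
    have : C - g p₀ ≤ (C - g p₀) / ε ^ 2 * barrier p₀ p := by
      rw [div_mul_eq_mul_div, le_div_iff₀ (by positivity)]
      gcongr
    linarith [hC p]

lemma min_iterate_gameStep_le {s κ C c N : ℝ} {f : Heis → ℝ} (hf : MidStrict s κ f) (hN : 0 ≤ N)
    {p₀ : Heis} (h : ∀ p, min (f p) C ≤ c + N * barrier p₀ p) (n : ℕ) (p : Heis) :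
    min ((gameStep s)^[n] f p) C ≤ c + N * ((1 + s ^ 2 / 4) ^ n * (barrier p₀ p + 4) - 4) := by
  induction n generalizing p with
  | zero => simpa using h p
  | succ n ih =>
    rw [Function.iterate_succ_apply']
    obtain ⟨v, hv, h1, h2⟩ := exists_barrier_move_le p₀ p s
    have hstep : ∀ q, barrier p₀ q + 4 ≤ (1 + s ^ 2 / 4) * (barrier p₀ p + 4) →
        min ((gameStep s)^[n] f q) C ≤
          c + N * ((1 + s ^ 2 / 4) ^ (n + 1) * (barrier p₀ p + 4) - 4) := fun q hq => by
      refine (ih q).trans ?_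
      rw [pow_succ (1 + s ^ 2 / 4) n, mul_assoc ((1 + s ^ 2 / 4) ^ n)]
      gcongr
    exact (min_le_max_min ((hf.iterate n).gameStep_le p hv)).trans
      (max_le (hstep _ h1) (hstep _ h2))

lemma gameValue_le_barrier {s κ C c N : ℝ} {f : Heis → ℝ} (hs : 0 < s) (hf : MidStrict s κ f)
    (hN : 0 ≤ N) {p₀ : Heis} (h : ∀ p, min (f p) C ≤ c + N * barrier p₀ p) (x : Heis × ℝ) :
    gameValue s C f x ≤ c + N * (Real.exp (max x.2 0 / 2) * (barrier p₀ x.1 + 4) - 4) := by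
  refine (min_iterate_gameStep_le hf hN h _ x.1).trans ?_
  have hb := barrier_nonneg p₀ x.1
  have hexp : (1 + s ^ 2 / 4) ^ ⌊2 * x.2 / s ^ 2⌋₊ ≤ Real.exp (max x.2 0 / 2) := by
    have h1 : 1 + s ^ 2 / 4 ≤ Real.exp (s ^ 2 / 4) := by
      linarith [Real.add_one_le_exp (s ^ 2 / 4)]
    refine (pow_le_pow_left₀ (by positivity) h1 _).trans ?_
    rw [← Real.exp_nat_mul, Real.exp_le_exp]
    have h2 : (⌊2 * x.2 / s ^ 2⌋₊ : ℝ) ≤ 2 * max x.2 0 / s ^ 2 :=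
      (Nat.cast_le.2 (Nat.floor_mono (by gcongr; exact le_max_left _ _))).trans
        (Nat.floor_le (by positivity))
    rw [le_div_iff₀ (by positivity)] at h2
    linarith
  gcongr

end Barrier

section Segments

lemma exists_eq_smul_unit (h : ℝ × ℝ) :
    ∃ R : ℝ, 0 ≤ R ∧ ∃ v : ℝ × ℝ, v.1 ^ 2 + v.2 ^ 2 = 1 ∧ h = R • v := by
  rcases eq_or_ne (√(h.1 ^ 2 + h.2 ^ 2)) 0 with h0 | h0
  · rw [Real.sqrt_eq_zero (by positivity)] at h0
    have h1 : h.1 = 0 := by nlinarith [sq_nonneg h.1, sq_nonneg h.2]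
    have h2 : h.2 = 0 := by nlinarith [sq_nonneg h.1, sq_nonneg h.2]
    exact ⟨0, le_rfl, (1, 0), by simp, by ext <;> simp [h1, h2]⟩
  · refine ⟨√(h.1 ^ 2 + h.2 ^ 2), Real.sqrt_nonneg _,
      (h.1 / √(h.1 ^ 2 + h.2 ^ 2), h.2 / √(h.1 ^ 2 + h.2 ^ 2)), ?_, ?_⟩
    · have hsq := Real.sq_sqrt (show 0 ≤ h.1 ^ 2 + h.2 ^ 2 by positivity)
      simp only [div_pow, hsq]
      rw [← add_div, div_self]
      rw [← hsq]
      exact pow_ne_zero 2 h0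
    · ext
      · simp only [Prod.smul_fst, smul_eq_mul]
        field_simp
      · simp only [Prod.smul_snd, smul_eq_mul]
        field_simp

/-- A horizontal segment starting at `p` is traced by `move p`. -/
lemma exists_move_of_mem_hSeg {p q w : Heis} (hq : q ∈ hPlane p) (hw : w ∈ hSeg p q) :
    ∃ v : ℝ × ℝ, v.1 ^ 2 + v.2 ^ 2 = 1 ∧ ∃ ρ R : ℝ, 0 ≤ ρ ∧ ρ ≤ R ∧
      w = move p (ρ • v) ∧ q = move p (R • v) := by
  obtain ⟨h, hh, rfl⟩ := hq
  obtain ⟨l, hl0, hl1, rfl⟩ := hw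
  obtain ⟨R, hR, v, hv, hhv⟩ := exists_eq_smul_unit (h.1, h.2.1)
  have h0 : h.2.2 = 0 := hh
  have h1 : h.1 = R * v.1 := congrArg Prod.fst hhv
  have h2 : h.2.1 = R * v.2 := congrArg Prod.snd hhv
  refine ⟨v, hv, (1 - l) * R, R, mul_nonneg (by linarith) hR, by nlinarith, ?_, ?_⟩ <;>
  · ext <;> simp only [move, hMul, Prod.fst_add, Prod.snd_add, Prod.smul_fst, Prod.smul_snd,
      smul_eq_mul, h0, h1, h2] <;> ring

lemma tendsto_floor_div_mul {s : ℕ → ℝ} (hs0 : ∀ j, 0 < s j) (hs : Tendsto s atTop (𝓝 0))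
    {R : ℝ} (hR : 0 ≤ R) : Tendsto (fun j => (⌊R / s j⌋₊ : ℝ) * s j) atTop (𝓝 R) := by
  refine tendsto_of_tendsto_of_tendsto_of_le_of_le (g := fun j => R - s j) (h := fun _ => R)
    (by simpa using hs.const_sub R) tendsto_const_nhds (fun j => ?_) fun j => ?_
  · have := Nat.lt_floor_add_one (R / s j)
    rw [div_lt_iff₀ (hs0 j)] at this
    simp only
    linarith
  · have := Nat.floor_le (div_nonneg hR (hs0 j).le)
    rwa [le_div_iff₀ (hs0 j)] at this

lemma tendsto_move {r : ℕ → ℝ} {R : ℝ} (hr : Tendsto r atTop (𝓝 R)) (p : Heis) (v : ℝ × ℝ) (t : ℝ) :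
    Tendsto (fun j => (j, (move p (r j • v), t))) atTop (atTop ×ˢ 𝓝 (move p (R • v), t)) := by
  have hc : Continuous fun r : ℝ => (move p (r • v), t) := by
    simp only [move, Prod.smul_fst, Prod.smul_snd, smul_eq_mul]
    fun_prop
  exact tendsto_id.prodMk ((hc.tendsto R).comp hr)

end Segments

lemma UniformlyHQuasiconvexOn.midStrict {f : Heis → ℝ} {r₀ lam s : ℝ}
    (hf : UniformlyHQuasiconvexOn f Set.univ r₀ lam) (hs : 0 < s) (hsr : s < r₀) :
    MidStrict s (lam * s ^ 2) f := fun p v hv => by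
  have h := hf s hs hsr p trivial (v.1, v.2, 0) rfl hv trivial trivial
  have e1 : hMul p (s • (v.1, v.2, 0)) = move p (s • v) := by
    ext <;> simp [hMul, move]
  have e2 : hMul p (-(s • (v.1, v.2, 0))) = move p (s • -v) := by
    ext <;> simp [hMul, move]
  rw [e1, e2] at h
  linarith

theorem statement12 (hCP : CPholds) (C : ℝ)
    (uhat₀ : Heis → ℝ) (hcont : Continuous uhat₀)
    (r₀ lam : ℝ) (hr₀ : 0 < r₀) (hlam : 0 < lam)
    (huqc : UniformlyHQuasiconvexOn uhat₀ Set.univ r₀ lam)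
    (L : ℝ) (hL : 0 < L) (hgrowth : ∀ p : Heis, uhat₀ p ≤ L * (gaugeK p ^ 4 + 1))
    (u₀ : Heis → ℝ) (hu₀ : u₀ = fun p => min (uhat₀ p) C)
    (hu₀le : ∀ p : Heis, u₀ p ≤ C)
    (K₀ : Set Heis) (hK₀ : IsCompact K₀) (hu₀out : ∀ p ∉ K₀, u₀ p = C)
    (u : Heis × ℝ → ℝ) (hucont : ContinuousOn u {q : Heis × ℝ | 0 ≤ q.2})
    (hsub : FlowSubsolution u) (hsup : FlowSupersolution u)
    (hinit : ∀ p : Heis, u (p, 0) = u₀ p)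
    (huleC : ∀ q : Heis × ℝ, 0 ≤ q.2 → u q ≤ C)
    (K : Set Heis) (hK : IsCompact K)
    (huout : ∀ q : Heis × ℝ, 0 ≤ q.2 → q.1 ∉ K → u q = C) :
    ∀ t : ℝ, 0 ≤ t → HQuasiconvexOn (fun p => u (p, t)) Set.univ := by
  subst hu₀
  set s : ℕ → ℝ := fun j => r₀ * (1 / ((j : ℝ) + 2)) with hs_def
  have hs0 : ∀ j, 0 < s j := fun j => by positivity
  have hs : Tendsto s atTop (𝓝 0) := by
    have h := (tendsto_one_div_add_atTop_nhds_zero_nat (𝕜 := ℝ)).comp (tendsto_add_atTop_nat 1)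
    simpa [hs_def, Function.comp_def, add_assoc, one_add_one_eq_two] using h.const_mul r₀
  have hmid : ∀ j, MidStrict (s j) (lam * s j ^ 2) uhat₀ := fun j => by
    refine huqc.midStrict (hs0 j) (mul_lt_of_lt_one_right hr₀ ?_)
    rw [div_lt_one (by positivity)]
    linarith [(Nat.cast_nonneg j : (0 : ℝ) ≤ j)]
  have hgap : ∀ j, 0 < lam * s j ^ 2 := fun j => mul_pos hlam (pow_pos (hs0 j) 2)
  set w : ℕ → Heis × ℝ → ℝ := fun j => gameValue (s j) C uhat₀ with hw
  have hwC : ∀ j x, w j x ≤ C := fun j x => min_le_right _ _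
  have hw₀ : ∀ j x, min (uhat₀ x.1) C ≤ w j x := fun j x =>
    min_le_min_right C ((hmid j).le_iterate (hgap j).le _ _)
  have hc₀ : Continuous fun p => min (uhat₀ p) C := hcont.min continuous_const
  have hc₁ : Continuous fun x : Heis × ℝ => min (uhat₀ x.1) C := hc₀.comp continuous_fst
  obtain ⟨M, hM⟩ : ∃ M, ∀ j x, |w j x| ≤ M := by
    obtain ⟨m, hm⟩ := (hK₀.image hc₀).bddBelow
    refine ⟨|m| + |C|, fun j x => abs_le.2 ⟨?_, ?_⟩⟩
    · by_cases hx : x.1 ∈ K₀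
      · linarith [hm ⟨x.1, hx, rfl⟩, hw₀ j x, neg_abs_le m, abs_nonneg C]
      · linarith [hu₀out x.1 hx, hw₀ j x, abs_nonneg m, neg_abs_le C]
    · linarith [hwC j x, abs_nonneg m, le_abs_self C]
  have hcC : ∀ x, ContinuousAt (fun _ : Heis × ℝ => C) x := fun x => continuousAt_const
  have hinit_upper : ∀ p, upperLim w (p, 0) ≤ min (uhat₀ p) C := fun p => by
    refine le_of_forall_pos_le_add fun η hη => ?_
    obtain ⟨N, hN, hbar⟩ := exists_le_add_mul_barrier hc₀ hu₀le p hη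
    have hcb := continuous_barrier p
    have h := upperLim_le_of_le hM (x := (p, 0))
      (g := fun x => min (uhat₀ p) C + η +
        N * (Real.exp (max x.2 0 / 2) * (barrier p x.1 + 4) - 4))
      (by fun_prop) (fun j x => gameValue_le_barrier (hs0 j) (hmid j) hN hbar x)
    simpa [barrier_self] using h
  have hupper : ∀ x : Heis × ℝ, 0 ≤ x.2 → upperLim w x ≤ u x := by
    refine hCP C (K ∪ K₀) (hK.union hK₀) _ u
      (upperSemicontinuous_upperLim hM |>.upperSemicontinuousOn _) hucont.lowerSemicontinuousOn
      (flowSubsolution_upperLim hM hs0 hs fun j x v hv hx => gameValue_le (hmid j) (hs0 j) hx hv)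
      hsup (fun x hx => ⟨upperLim_le_of_le hM (hcC x) hwC, huleC x hx⟩)
      (fun x hx hxK => ⟨le_antisymm (upperLim_le_of_le hM (hcC x) hwC) ?_,
        huout x hx fun h => hxK (Or.inl h)⟩) (fun p => (hinit_upper p).trans (hinit p).ge)
    exact (hu₀out x.1 fun h => hxK (Or.inr h)).ge.trans
      (le_upperLim_of_le hM hc₁.continuousAt hw₀)
  have hlower : ∀ x : Heis × ℝ, 0 ≤ x.2 → u x ≤ lowerLim w x := by
    refine hCP C (K ∪ K₀) (hK.union hK₀) u _ hucont.upperSemicontinuousOn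
      (lowerSemicontinuous_lowerLim hM |>.lowerSemicontinuousOn _) hsub
      (flowSupersolution_lowerLim hM hs0 hs fun j x hx =>
        exists_max_le_gameValue_add (hs0 j) hx (pow_pos (hs0 j) 3))
      (fun x hx => ⟨huleC x hx, lowerLim_le_of_le hM (hcC x) hwC⟩)
      (fun x hx hxK => ⟨huout x hx fun h => hxK (Or.inl h),
        le_antisymm (lowerLim_le_of_le hM (hcC x) hwC) ?_⟩)
      (fun p => (hinit p).le.trans (le_lowerLim_of_le (x := (p, 0)) hM hc₁.continuousAt hw₀))
    exact (hu₀out x.1 fun h => hxK (Or.inr h)).ge.trans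
      (le_lowerLim_of_le hM hc₁.continuousAt hw₀)
  intro t ht p _ q _ hq z hz
  obtain ⟨v, hv, ρ, R, hρ, hρR, rfl, rfl⟩ := exists_move_of_mem_hSeg hq hz
  by_contra! hlt
  obtain ⟨a, ha, haz⟩ := exists_between hlt
  obtain ⟨hap, haq⟩ := max_lt_iff.1 ha
  have hp0 : move p ((0 : ℝ) • v) = p := by simp [move]
  have hevp := (tendsto_move (tendsto_const_nhds (x := (0 : ℝ))) p v t).eventually
    (eventually_lt_of_upperLim_lt hM ((hupper _ ht).trans_lt (hp0.symm ▸ hap)))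
  have hevq := (tendsto_move (tendsto_floor_div_mul hs0 hs (hρ.trans hρR)) p v t).eventually
    (eventually_lt_of_upperLim_lt hM ((hupper _ ht).trans_lt haq))
  have hevz := (tendsto_move (tendsto_floor_div_mul hs0 hs hρ) p v t).eventually
    (eventually_lt_of_upperLim_lt (w := fun j y => -w j y) (M := M)
      (fun j x => by rw [abs_neg]; exact hM j x)
      (lt_neg.1 (haz.trans_le (hlower (move p (ρ • v), t) ht))))
  obtain ⟨j, hjp, hjq, hjz⟩ := (hevp.and (hevq.and hevz)).exists
  have h := gameValue_progression_le (C := C) (hmid j) (hgap j) p hv t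
    (Nat.floor_mono (div_le_div_of_nonneg_right hρR (hs0 j).le))
  rw [hp0] at hjp
  exact absurd (neg_lt_neg_iff.1 hjz) (not_lt.2 (h.trans (max_lt hjp hjq).le))
end
end

section
/- Let E₀ ⊂ ℍ be a nonempty open bounded set satisfying conditions (S1) and (S2). Then there exist a constant L > 0 and a continuous function û₀: ℍ → ℝ that is uniformly h-quasiconvex in ℍ and satisfies: E₀ = {p ∈ ℍ : û₀(p) < 0}, û₀(p) ≤ L(|p|_G⁴ + 1) for all p ∈ ℍ, and û₀(p) → ∞ as |p|_G → ∞. -/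
open Filter Topology

noncomputable section

open scoped Classical

/-- Non-isotropic dilation `δ_λ(x,y,z) = (λx, λy, λ²z)`. -/
def dilH (l : ℝ) (p : Heis) : Heis := (l * p.1, l * p.2.1, l ^ 2 * p.2.2)

/-- Condition (S1): `δ_μ(closure E) ⊆ E` for all `0 < μ < 1`. -/
def S1cond (E : Set Heis) : Prop :=
  ∀ μ : ℝ, 0 < μ → μ < 1 → ∀ p ∈ closure E, dilH μ p ∈ E

/-- Minkowski-type functional `U₀` of an open bounded set `E`. -/
def mink (E : Set Heis) (p : Heis) : ℝ :=
  if p = 0 then 0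
  else sSup {m : ℝ | ∃ μ : ℝ, 0 < μ ∧ dilH μ p ∉ E ∧ m = 1 / μ ^ 2}

/-- Condition (S2): a reinforced h-convexity of `E` via its Minkowski functional. -/
def S2cond (E : Set Heis) : Prop :=
  ∃ r₀ : ℝ, 0 < r₀ ∧ ∃ σ : ℝ, 0 < σ ∧ ∀ r : ℝ, 0 < r → r < r₀ →
    ∀ p ∈ frontier E, ∀ v ∈ horiz, v.1 ^ 2 + v.2.1 ^ 2 = 1 →
      1 + σ * r ^ 2 ≤ max (mink E (hMul p (r • v))) (mink E (hMul p (-(r • v))))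

lemma dilH_dilH (a b : ℝ) (p : Heis) : dilH a (dilH b p) = dilH (a * b) p := by
  simp only [dilH, mul_pow, mul_assoc]

lemma dilH_one (p : Heis) : dilH 1 p = p := by
  simp [dilH]

@[simp] lemma dilH_zero_left (p : Heis) : dilH 0 p = 0 := by
  simp [dilH]

@[simp] lemma dilH_zero_right (a : ℝ) : dilH a 0 = 0 := by
  simp [dilH]

lemma continuous_dilH : Continuous fun q : ℝ × Heis => dilH q.1 q.2 := by
  unfold dilH
  fun_prop

lemma dilH_hMul (a : ℝ) (p q : Heis) : dilH a (hMul p q) = hMul (dilH a p) (dilH a q) := by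
  simp only [dilH, hMul, Prod.mk.injEq]
  refine ⟨?_, ?_, ?_⟩ <;> ring

lemma dilH_smul_horiz (a r : ℝ) {v : Heis} (hv : v ∈ horiz) :
    dilH a (r • v) = (a * r) • v := by
  have hv : v.2.2 = 0 := hv
  simp only [dilH, Prod.smul_fst, Prod.smul_snd, smul_eq_mul, hv, mul_zero]
  ext <;> simp [hv, mul_assoc]

lemma hMul_hMul_smul (p v : Heis) (s t : ℝ) :
    hMul (hMul p (s • v)) (t • v) = hMul p ((s + t) • v) := by
  simp only [hMul, Prod.smul_fst, Prod.smul_snd, smul_eq_mul, Prod.mk.injEq]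
  refine ⟨?_, ?_, ?_⟩ <;> ring

lemma continuous_hMul_smul (p v : Heis) : Continuous fun t : ℝ => hMul p (t • v) := by
  unfold hMul
  fun_prop

lemma gaugeK_pow_four (p : Heis) :
    gaugeK p ^ 4 = (p.1 ^ 2 + p.2.1 ^ 2) ^ 2 + 16 * p.2.2 ^ 2 := by
  unfold gaugeK
  rw [← Real.rpow_natCast, ← Real.rpow_mul (by positivity)]
  norm_num

/-- If a continuous function on `[-r, r]` has no interior point at which it is locally dominated
strictly by its values on both sides, then its values are bounded by those at the endpoints. -/
lemma le_max_endpoints {g : ℝ → ℝ} (hg : Continuous g) {m r : ℝ} (hr : 0 < r)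
    (hloc : ∀ t, m < g t → ∃ δ > 0, ∀ ε, 0 < ε → ε < δ →
      g t < max (g (t + ε)) (g (t - ε)))
    {t : ℝ} (ht : t ∈ Set.Icc (-r) r) (hmt : m < g t) : g t ≤ max (g r) (g (-r)) := by
  obtain ⟨t₀, ht₀, hmax⟩ := isCompact_Icc.exists_isMaxOn ⟨t, ht⟩ hg.continuousOn
  have hmax : ∀ x ∈ Set.Icc (-r) r, g x ≤ g t₀ := hmax
  refine (hmax t ht).trans ?_
  by_contra! hlt
  have h1 : t₀ ≠ r := by
    rintro rfl
    exact absurd hlt (not_lt.2 (le_max_left _ _))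
  have h2 : t₀ ≠ -r := by
    rintro rfl
    exact absurd hlt (not_lt.2 (le_max_right _ _))
  have h1' : 0 < r - t₀ := sub_pos.2 (lt_of_le_of_ne ht₀.2 h1)
  have h2' : 0 < t₀ + r := by
    have := lt_of_le_of_ne ht₀.1 h2.symm
    linarith
  obtain ⟨δ, hδ, h⟩ := hloc t₀ (hmt.trans_le (hmax t ht))
  obtain ⟨ε, hε, hε'⟩ := exists_between (lt_min hδ (lt_min h1' h2'))
  have ha := lt_min_iff.1 hε'
  have hb := lt_min_iff.1 ha.2
  refine absurd (h ε hε ha.1) (not_lt.2 (max_le ?_ ?_))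
  · exact hmax _ ⟨by linarith, by linarith⟩
  · exact hmax _ ⟨by linarith, by linarith⟩

section Minkowski

variable {E : Set Heis}

lemma S1cond.zero_mem (hS1 : S1cond E) (hne : E.Nonempty) : (0 : Heis) ∈ E := by
  obtain ⟨p, hp⟩ := hne
  have hlim : Tendsto (fun μ : ℝ => dilH μ p) (𝓝[>] 0) (𝓝 0) := by
    have hc : Continuous fun μ : ℝ => dilH μ p :=
      continuous_dilH.comp (continuous_id.prodMk continuous_const)
    have := (hc.tendsto 0).mono_left (nhdsWithin_le_nhds (s := Set.Ioi 0))
    simpa using this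
  have hcl : (0 : Heis) ∈ closure E := by
    refine mem_closure_of_tendsto hlim ?_
    filter_upwards [Ioo_mem_nhdsGT (zero_lt_one (α := ℝ))] with μ hμ
    exact hS1 μ hμ.1 hμ.2 p (subset_closure hp)
  simpa using hS1 (1 / 2) (by norm_num) (by norm_num) 0 hcl

lemma S1cond.dilH_mem_of_lt (hS1 : S1cond E) {p : Heis} {a b : ℝ} (ha : 0 < a) (hab : a < b)
    (h : dilH b p ∈ closure E) : dilH a p ∈ E := by
  have hb := ha.trans hab
  have := hS1 (a / b) (by positivity) ((div_lt_one hb).2 hab) _ h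
  rwa [dilH_dilH, div_mul_cancel₀ _ hb.ne'] at this

lemma mink_nonneg (E : Set Heis) (p : Heis) : 0 ≤ mink E p := by
  unfold mink
  split_ifs
  · exact le_rfl
  · refine Real.sSup_nonneg ?_
    rintro _ ⟨μ, -, -, rfl⟩
    positivity

lemma mink_lt_iff_dilH_mem (hne : E.Nonempty) (hopen : IsOpen E) (hS1 : S1cond E) (p : Heis)
    {μ : ℝ} (hμ : 0 < μ) : mink E p < 1 / μ ^ 2 ↔ dilH μ p ∈ E := by
  have h0 := hS1.zero_mem hne
  rcases eq_or_ne p 0 with rfl | hp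
  · simp only [mink, if_true, dilH_zero_right, h0, iff_true]
    positivity
  have hc : Continuous fun μ : ℝ => dilH μ p :=
    continuous_dilH.comp (continuous_id.prodMk continuous_const)
  have hbound : ∀ a, 0 < a → dilH a p ∈ E →
      ∀ m ∈ {m : ℝ | ∃ ν : ℝ, 0 < ν ∧ dilH ν p ∉ E ∧ m = 1 / ν ^ 2}, m ≤ 1 / a ^ 2 := by
    rintro a ha hmem _ ⟨ν, hν, hnot, rfl⟩
    have : a ≤ ν := by
      by_contra! hlt
      exact hnot (hS1.dilH_mem_of_lt hν hlt (subset_closure hmem))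
    gcongr
  simp only [mink, if_neg hp]
  constructor
  · intro hlt
    by_contra hnot
    have hbdd : BddAbove {m : ℝ | ∃ ν : ℝ, 0 < ν ∧ dilH ν p ∉ E ∧ m = 1 / ν ^ 2} := by
      have hev : ∀ᶠ a in 𝓝 (0 : ℝ), dilH a p ∈ E :=
        hc.continuousAt.eventually (hopen.mem_nhds (by simpa using h0))
      obtain ⟨a, hmem, ha⟩ :=
        ((hev.filter_mono nhdsWithin_le_nhds).and (self_mem_nhdsWithin (s := Set.Ioi 0))).exists
      exact ⟨_, hbound a ha hmem⟩
    exact absurd hlt (not_lt.2 (le_csSup hbdd ⟨μ, hμ, hnot, rfl⟩))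
  · intro hmem
    have hev : ∀ᶠ a in 𝓝 μ, dilH a p ∈ E := hc.continuousAt.eventually (hopen.mem_nhds hmem)
    obtain ⟨a, hmem', ha⟩ :=
      ((hev.filter_mono nhdsWithin_le_nhds).and (self_mem_nhdsWithin (s := Set.Ioi μ))).exists
    have ha : μ < a := ha
    refine (Real.sSup_le (hbound a (hμ.trans ha) hmem') (by positivity)).trans_lt ?_
    gcongr

lemma mink_lt_iff (hne : E.Nonempty) (hopen : IsOpen E) (hS1 : S1cond E) (p : Heis)
    {c : ℝ} (hc : 0 < c) : mink E p < c ↔ dilH (√c)⁻¹ p ∈ E := by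
  rw [← mink_lt_iff_dilH_mem hne hopen hS1 p (inv_pos.2 (Real.sqrt_pos.2 hc))]
  simp [Real.sq_sqrt hc.le]

lemma mink_dilH (hne : E.Nonempty) (hopen : IsOpen E) (hS1 : S1cond E) (p : Heis)
    {s : ℝ} (hs : 0 < s) : mink E (dilH s p) = s ^ 2 * mink E p := by
  refine eq_of_forall_gt_iff fun c => ?_
  rcases le_or_gt c 0 with hc | hc
  · exact iff_of_false (not_lt.2 (hc.trans (mink_nonneg E _)))
      (not_lt.2 (hc.trans (mul_nonneg (sq_nonneg s) (mink_nonneg E p))))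
  · rw [mink_lt_iff hne hopen hS1 _ hc, dilH_dilH, ← lt_div_iff₀' (by positivity),
      mink_lt_iff hne hopen hS1 _ (by positivity), Real.sqrt_div hc.le, Real.sqrt_sq hs.le, inv_div,
      inv_mul_eq_div]

lemma continuous_mink (hne : E.Nonempty) (hopen : IsOpen E) (hS1 : S1cond E) :
    Continuous (mink E) := by
  have hdil : ∀ a : ℝ, Continuous (dilH a) := fun a =>
    continuous_dilH.comp (continuous_const.prodMk continuous_id)
  rw [continuous_iff_lower_upperSemicontinuous]
  constructor
  · intro p c hcp
    rcases lt_or_ge c 0 with hc | hc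
    · exact Eventually.of_forall fun q => hc.trans_le (mink_nonneg E q)
    obtain ⟨d, hcd, hdp⟩ := exists_between hcp
    obtain ⟨e, hde, hep⟩ := exists_between hdp
    have hd := hc.trans_lt hcd
    have hnot : dilH (√d)⁻¹ p ∈ (closure E)ᶜ := by
      intro hmem
      refine absurd hep (not_lt.2 ((mink_lt_iff hne hopen hS1 p (hd.trans hde)).2 ?_).le)
      have := Real.sqrt_pos.2 hd
      have := Real.sqrt_lt_sqrt hd.le hde
      have := Real.sqrt_pos.2 (hd.trans hde)
      exact hS1.dilH_mem_of_lt (by positivity) (by gcongr) hmem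
    filter_upwards [(hdil _).continuousAt.eventually
      (isClosed_closure.isOpen_compl.mem_nhds hnot)] with q hq
    refine hcd.trans_le (not_lt.1 fun hlt => hq (subset_closure ?_))
    exact (mink_lt_iff hne hopen hS1 q hd).1 hlt
  · intro p c hpc
    have hc := (mink_nonneg E p).trans_lt hpc
    filter_upwards [(hdil _).continuousAt.eventually
      (hopen.mem_nhds ((mink_lt_iff hne hopen hS1 p hc).1 hpc))] with q hq
    exact (mink_lt_iff hne hopen hS1 q hc).2 hq

lemma mink_lt_one_iff (hne : E.Nonempty) (hopen : IsOpen E) (hS1 : S1cond E) (p : Heis) :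
    mink E p < 1 ↔ p ∈ E := by
  simpa [dilH_one] using mink_lt_iff hne hopen hS1 p one_pos

lemma mem_frontier_of_mink_eq_one (hne : E.Nonempty) (hopen : IsOpen E) (hS1 : S1cond E)
    {p : Heis} (hp : mink E p = 1) : p ∈ frontier E := by
  rw [hopen.frontier_eq]
  refine ⟨?_, fun h => ((mink_lt_one_iff hne hopen hS1 p).2 h).ne hp⟩
  have hlim : Tendsto (fun μ : ℝ => dilH μ p) (𝓝[<] 1) (𝓝 p) := by
    have hc : Continuous fun μ : ℝ => dilH μ p :=
      continuous_dilH.comp (continuous_id.prodMk continuous_const)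
    have := (hc.tendsto 1).mono_left (nhdsWithin_le_nhds (s := Set.Iio 1))
    simpa [dilH_one] using this
  refine mem_closure_of_tendsto hlim ?_
  filter_upwards [Ioo_mem_nhdsLT (zero_lt_one (α := ℝ))] with μ hμ
  rw [← mink_lt_one_iff hne hopen hS1, mink_dilH hne hopen hS1 p hμ.1, hp]
  nlinarith [hμ.1, hμ.2]

lemma exists_coord_le_mink (hne : E.Nonempty) (hopen : IsOpen E) (hS1 : S1cond E)
    (hbdd : Bornology.IsBounded E) : ∃ R > 0, ∀ p : Heis,
      p.1 ^ 2 + p.2.1 ^ 2 ≤ R * mink E p ∧ |p.2.2| ≤ R * mink E p := by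
  obtain ⟨R, hR, hER⟩ := hbdd.exists_pos_norm_le
  have key : ∀ p : Heis, ∀ c > mink E p,
      p.1 ^ 2 + p.2.1 ^ 2 ≤ (2 * R ^ 2 + R) * c ∧ |p.2.2| ≤ (2 * R ^ 2 + R) * c := by
    intro p c hc
    have hc0 := (mink_nonneg E p).trans_lt hc
    have h := hER _ ((mink_lt_iff hne hopen hS1 p hc0).1 hc)
    have hs := Real.sqrt_pos.2 hc0
    simp only [dilH, Prod.norm_def, sup_le_iff, Real.norm_eq_abs] at h
    obtain ⟨h1, h2, h3⟩ := h
    rw [abs_mul, abs_of_pos (inv_pos.2 hs), inv_mul_le_iff₀ hs] at h1 h2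
    rw [inv_pow, Real.sq_sqrt hc0.le, abs_mul, abs_of_pos (inv_pos.2 hc0),
      inv_mul_le_iff₀ hc0] at h3
    have e1 := pow_le_pow_left₀ (abs_nonneg _) h1 2
    have e2 := pow_le_pow_left₀ (abs_nonneg _) h2 2
    rw [sq_abs, mul_pow, Real.sq_sqrt hc0.le] at e1 e2
    have : 0 < R * c := by positivity
    have : 0 < R ^ 2 * c := by positivity
    constructor <;> linarith
  refine ⟨2 * R ^ 2 + R, by positivity, fun p => ?_⟩
  have hlim : Tendsto (fun c => (2 * R ^ 2 + R) * c) (𝓝[>] mink E p)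
      (𝓝 ((2 * R ^ 2 + R) * mink E p)) :=
    ((continuous_const.mul continuous_id).tendsto _).mono_left nhdsWithin_le_nhds
  exact ⟨ge_of_tendsto hlim (eventually_mem_nhdsWithin.mono fun c hc => (key p c hc).1),
    ge_of_tendsto hlim (eventually_mem_nhdsWithin.mono fun c hc => (key p c hc).2)⟩

lemma exists_mink_le_gaugeK (hne : E.Nonempty) (hopen : IsOpen E) (hS1 : S1cond E) :
    ∃ L > 0, ∀ p : Heis, mink E p ≤ L * (gaugeK p ^ 4 + 1) := by
  obtain ⟨ε, hε, hball⟩ := Metric.isOpen_iff.1 hopen 0 (hS1.zero_mem hne)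
  set K := 1 / ε ^ 2 + 1 / ε + 1 with hK
  have hK0 : 0 < K := by positivity
  have hK1 : 1 < ε ^ 2 * K := by
    have : ε ^ 2 * K = 1 + ε + ε ^ 2 := by rw [hK]; field_simp
    rw [this]; nlinarith
  have hK2 : 1 < ε * K := by
    have : ε * K = 1 / ε + 1 + ε := by rw [hK]; field_simp
    rw [this]
    have : 0 < 1 / ε := by positivity
    linarith
  refine ⟨K, hK0, fun p => ?_⟩
  rw [gaugeK_pow_four]
  set G := (p.1 ^ 2 + p.2.1 ^ 2) ^ 2 + 16 * p.2.2 ^ 2 + 1 with hG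
  have hG0 : 0 < G := by positivity
  have hc : 0 < K * G := by positivity
  have hs := Real.sqrt_pos.2 hc
  have hxy : p.1 ^ 2 + p.2.1 ^ 2 ≤ G := by
    rw [hG]; nlinarith [sq_nonneg (p.1 ^ 2 + p.2.1 ^ 2 - 1), sq_nonneg p.2.2]
  have hz : |p.2.2| ≤ G := by
    rw [hG, ← sq_abs p.2.2]
    nlinarith [sq_nonneg (|p.2.2| - 1), sq_nonneg (p.1 ^ 2 + p.2.1 ^ 2), abs_nonneg p.2.2]
  have hlt : ∀ x : ℝ, x ^ 2 ≤ G → |x| < √(K * G) * ε := by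
    intro x hx
    refine abs_lt_of_sq_lt_sq ?_ (by positivity)
    rw [mul_pow, Real.sq_sqrt hc.le]
    nlinarith
  refine ((mink_lt_iff hne hopen hS1 p hc).2 (hball ?_)).le
  rw [mem_ball_zero_iff]
  simp only [dilH, Prod.norm_def, sup_lt_iff, Real.norm_eq_abs]
  refine ⟨?_, ?_, ?_⟩
  · rw [abs_mul, abs_of_pos (inv_pos.2 hs), inv_mul_lt_iff₀ hs]
    exact hlt _ (by nlinarith [sq_nonneg p.2.1])
  · rw [abs_mul, abs_of_pos (inv_pos.2 hs), inv_mul_lt_iff₀ hs]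
    exact hlt _ (by nlinarith [sq_nonneg p.1])
  · rw [inv_pow, Real.sq_sqrt hc.le, abs_mul, abs_of_pos (inv_pos.2 hc), inv_mul_lt_iff₀ hc]
    nlinarith

/-- Condition (S2) propagates from the boundary to all nonzero levels of the functional. -/
lemma mink_add_le_max (hne : E.Nonempty) (hopen : IsOpen E) (hS1 : S1cond E) {r₀ σ : ℝ}
    (hS2 : ∀ r : ℝ, 0 < r → r < r₀ → ∀ p ∈ frontier E, ∀ v ∈ horiz, v.1 ^ 2 + v.2.1 ^ 2 = 1 →
      1 + σ * r ^ 2 ≤ max (mink E (hMul p (r • v))) (mink E (hMul p (-(r • v)))))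
    {p v : Heis} (hv : v ∈ horiz) (hv1 : v.1 ^ 2 + v.2.1 ^ 2 = 1) {s r : ℝ} (hs : 0 < s)
    (hp : mink E p = s ^ 2) (hr : 0 < r) (hrs : r < r₀ * s) :
    s ^ 2 + σ * r ^ 2 ≤ max (mink E (hMul p (r • v))) (mink E (hMul p ((-r) • v))) := by
  have hq : mink E (dilH s⁻¹ p) = 1 := by
    rw [mink_dilH hne hopen hS1 p (inv_pos.2 hs), hp]
    field_simp
  have h := hS2 (s⁻¹ * r) (by positivity) (by rwa [inv_mul_lt_iff₀ hs, mul_comm]) _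
    (mem_frontier_of_mink_eq_one hne hopen hS1 hq) v hv hv1
  rw [← neg_smul, ← mul_neg, ← dilH_smul_horiz _ _ hv, ← dilH_smul_horiz _ _ hv, ← dilH_hMul,
    ← dilH_hMul, mink_dilH hne hopen hS1 _ (inv_pos.2 hs), mink_dilH hne hopen hS1 _ (inv_pos.2 hs),
    ← mul_max_of_nonneg _ _ (by positivity)] at h
  have h := mul_le_mul_of_nonneg_left h (sq_nonneg s)
  field_simp at h
  linarith

lemma exists_uniformlyHQuasiconvexOn_mink (hne : E.Nonempty) (hopen : IsOpen E)
    (hbdd : Bornology.IsBounded E) (hS1 : S1cond E) (hS2 : S2cond E) :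
    ∃ lam > 0, ∀ r₁, UniformlyHQuasiconvexOn (mink E) Set.univ r₁ lam := by
  obtain ⟨r₀, hr₀, σ, hσ, hS2⟩ := hS2
  obtain ⟨R, hR, hcoord⟩ := exists_coord_le_mink hne hopen hS1 hbdd
  have hlocal := fun {p v : Heis} => mink_add_le_max (p := p) (v := v) hne hopen hS1 hS2
  refine ⟨min σ (min (1 / (2 * R)) (σ * r₀ ^ 2 / (8 * R))), by positivity, ?_⟩
  rintro r₁ r hr - p - v hv hv1 - -
  set lam := min σ (min (1 / (2 * R)) (σ * r₀ ^ 2 / (8 * R))) with hlam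
  have hl1 : lam ≤ σ := min_le_left _ _
  have hl2 : lam ≤ 1 / (2 * R) := (min_le_right _ _).trans (min_le_left _ _)
  have hl3 : lam ≤ σ * r₀ ^ 2 / (8 * R) := (min_le_right _ _).trans (min_le_right _ _)
  have hr2 : 0 < r ^ 2 := by positivity
  rw [← neg_smul, le_sub_iff_add_le]
  rcases le_or_gt (mink E p) (r ^ 2 / (2 * R)) with hsmall | hlarge
  · have hmax : r ^ 2 / R ≤ max (mink E (hMul p (r • v))) (mink E (hMul p ((-r) • v))) := by
      have h1 := (hcoord (hMul p (r • v))).1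
      have h2 := (hcoord (hMul p ((-r) • v))).1
      simp only [hMul, Prod.smul_fst, Prod.smul_snd, smul_eq_mul] at h1 h2 ⊢
      rw [div_le_iff₀ hR]
      rcases le_total 0 (p.1 * v.1 + p.2.1 * v.2.1) with h | h
      · refine le_trans ?_ (mul_le_mul_of_nonneg_right (le_max_left _ _) hR.le)
        nlinarith [mul_nonneg hr.le h, sq_nonneg p.1, sq_nonneg p.2.1]
      · refine le_trans ?_ (mul_le_mul_of_nonneg_right (le_max_right _ _) hR.le)
        nlinarith [mul_nonneg hr.le (neg_nonneg.2 h), sq_nonneg p.1, sq_nonneg p.2.1]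
    refine le_trans ?_ hmax
    have : lam * r ^ 2 ≤ 1 / (2 * R) * r ^ 2 := by gcongr
    calc mink E p + lam * r ^ 2 ≤ r ^ 2 / (2 * R) + 1 / (2 * R) * r ^ 2 := add_le_add hsmall this
      _ = r ^ 2 / R := by field_simp; norm_num
  · have hp0 : 0 < mink E p := lt_trans (by positivity) hlarge
    have hs := Real.sqrt_pos.2 hp0
    have hsq : √(mink E p) ^ 2 = mink E p := Real.sq_sqrt hp0.le
    set s := √(mink E p) with hs_def
    rcases lt_or_ge r (r₀ * s) with hlt | hge
    · have h := hlocal hv hv1 hs hsq.symm hr hlt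
      rw [hsq] at h
      refine le_trans ?_ h
      gcongr
    · have h := hlocal hv hv1 hs hsq.symm (r := r₀ * s / 2) (by positivity)
        (half_lt_self (by positivity))
      have hmid : ∀ t ∈ Set.Icc (-r) r, 0 < mink E (hMul p (t • v)) →
          mink E (hMul p (t • v)) ≤
            max (mink E (hMul p (r • v))) (mink E (hMul p ((-r) • v))) := by
        intro t ht ht0
        refine le_max_endpoints (g := fun t => mink E (hMul p (t • v))) (m := 0)
          ((continuous_mink hne hopen hS1).comp (continuous_hMul_smul p v)) hr ?_ ht ht0
        intro t ht
        have hs' := Real.sqrt_pos.2 ht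
        refine ⟨r₀ * √(mink E (hMul p (t • v))), by positivity, fun ε hε hε' => ?_⟩
        have := hlocal hv hv1 hs' (Real.sq_sqrt ht.le).symm hε hε'
        rw [Real.sq_sqrt ht.le, hMul_hMul_smul, hMul_hMul_smul, ← sub_eq_add_neg] at this
        refine lt_of_lt_of_le ?_ this
        have : 0 < σ * ε ^ 2 := by positivity
        linarith
      have hbound : mink E p + lam * r ^ 2 ≤ s ^ 2 + σ * (r₀ * s / 2) ^ 2 := by
        rw [hsq]
        have h1 : r ^ 2 ≤ mink E p * (2 * R) := ((div_lt_iff₀ (by positivity)).1 hlarge).le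
        have h2 : lam * r ^ 2 ≤ σ * r₀ ^ 2 / (8 * R) * (mink E p * (2 * R)) := by gcongr
        have h3 : σ * r₀ ^ 2 / (8 * R) * (mink E p * (2 * R)) = σ * (r₀ * s / 2) ^ 2 := by
          rw [← hsq]; field_simp; norm_num
        linarith
      have hpos : 0 < s ^ 2 + σ * (r₀ * s / 2) ^ 2 := by positivity
      refine hbound.trans ?_
      rcases le_max_iff.1 h with h | h
      · exact h.trans (hmid _ ⟨by linarith [mul_pos hr₀ hs], by linarith [mul_pos hr₀ hs]⟩
          (hpos.trans_le h))
      · exact h.trans (hmid _ ⟨by linarith [mul_pos hr₀ hs], by linarith [mul_pos hr₀ hs]⟩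
          (hpos.trans_le h))

lemma tendsto_mink_atTop (hne : E.Nonempty) (hopen : IsOpen E) (hbdd : Bornology.IsBounded E)
    (hS1 : S1cond E) : Tendsto (mink E) (comap gaugeK atTop) atTop := by
  obtain ⟨R, hR, hcoord⟩ := exists_coord_le_mink hne hopen hS1 hbdd
  have hle : ∀ p, gaugeK p ^ 4 ≤ (17 * R ^ 2) * mink E p ^ 2 := by
    intro p
    obtain ⟨h1, h2⟩ := hcoord p
    have e1 := pow_le_pow_left₀ (by positivity) h1 2
    have e2 := pow_le_pow_left₀ (abs_nonneg _) h2 2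
    rw [sq_abs] at e2
    rw [gaugeK_pow_four]
    linarith
  have h4 : Tendsto (fun p => gaugeK p ^ 4) (comap gaugeK atTop) atTop :=
    (tendsto_pow_atTop four_ne_zero).comp tendsto_comap
  have hsq : Tendsto (fun p => mink E p ^ 2) (comap gaugeK atTop) atTop :=
    (tendsto_const_mul_atTop_of_pos (by positivity)).1 (tendsto_atTop_mono hle h4)
  refine tendsto_atTop.2 fun b => ?_
  filter_upwards [hsq.eventually_ge_atTop (b ^ 2)] with p hp
  exact le_of_sq_le_sq hp (mink_nonneg E p)

end Minkowski

theorem statement17 (E₀ : Set Heis) (hne : E₀.Nonempty) (hopen : IsOpen E₀)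
    (hbdd : Bornology.IsBounded E₀) (hS1 : S1cond E₀) (hS2 : S2cond E₀) :
    ∃ L : ℝ, 0 < L ∧ ∃ uhat₀ : Heis → ℝ, Continuous uhat₀ ∧
      (∃ r₀ lam : ℝ, 0 < r₀ ∧ 0 < lam ∧ UniformlyHQuasiconvexOn uhat₀ Set.univ r₀ lam) ∧
      E₀ = {p : Heis | uhat₀ p < 0} ∧
      (∀ p : Heis, uhat₀ p ≤ L * (gaugeK p ^ 4 + 1)) ∧
      Tendsto uhat₀ (comap gaugeK atTop) atTop := by
  obtain ⟨L, hL, hle⟩ := exists_mink_le_gaugeK hne hopen hS1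
  obtain ⟨lam, hlam, hconv⟩ := exists_uniformlyHQuasiconvexOn_mink hne hopen hbdd hS1 hS2
  refine ⟨L, hL, fun p => mink E₀ p - 1, (continuous_mink hne hopen hS1).sub continuous_const,
    ⟨1, lam, one_pos, hlam, ?_⟩, ?_, fun p => ?_, ?_⟩
  · intro r hr hr1 p hp v hv hv1 h1 h2
    have := hconv 1 r hr hr1 p hp v hv hv1 h1 h2
    rw [max_sub_sub_right]
    linarith
  · ext p
    simp [mink_lt_one_iff hne hopen hS1]
  · linarith [hle p]
  · simpa only [sub_eq_add_neg] using
      tendsto_atTop_add_const_right _ (-1) (tendsto_mink_atTop hne hopen hbdd hS1)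
end
end

section
/- Let a < 0 < b and g ∈ C²([a,b]) with g > 0 on (a,b) and g(a) = g(b) = 0, and let E₀ = {(x,y,z) ∈ ℍ : x² + y² < g(z), z ∈ (a,b)}. If g(z) < (1/μ)·g(μz) for all 0 < μ < 1 and all z ∈ [a,b], then E₀ satisfies condition (S1), i.e., δ_μ(closure(E₀)) ⊂ E₀ for all 0 < μ < 1. In particular, if g is monotonically increasing on [a,0] and monotonically decreasing on [0,b], then E₀ satisfies (S1). -/
open Filter Topology

noncomputable section

open scoped Classical

/-- Points in the closure of a body of revolution satisfy the non-strict defining inequalities. -/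
theorem mem_Icc_and_le_of_mem_closure {a b : ℝ} (hab : a ≤ b) {g : ℝ → ℝ}
    (hg : ContinuousOn g (Set.Icc a b)) {p : Heis}
    (hp : p ∈ closure {p : Heis | a < p.2.2 ∧ p.2.2 < b ∧ p.1 ^ 2 + p.2.1 ^ 2 < g p.2.2}) :
    p.2.2 ∈ Set.Icc a b ∧ p.1 ^ 2 + p.2.1 ^ 2 ≤ g p.2.2 := by
  let G : ℝ → ℝ := Set.IccExtend hab (Set.domRestrict (Set.Icc a b) g)
  have hG : Continuous G := hg.domRestrict.Icc_extend'
  have hGg : ∀ z ∈ Set.Icc a b, G z = g z := fun z hz => Set.IccExtend_of_mem hab _ hz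
  have hclosed : IsClosed {q : Heis | q.2.2 ∈ Set.Icc a b ∧ q.1 ^ 2 + q.2.1 ^ 2 ≤ G q.2.2} :=
    (isClosed_Icc.preimage (by fun_prop : Continuous fun q : Heis => q.2.2)).inter
      (isClosed_le (f := fun q : Heis => q.1 ^ 2 + q.2.1 ^ 2) (g := fun q => G q.2.2)
        (by fun_prop) (by fun_prop))
  have hsub : {p : Heis | a < p.2.2 ∧ p.2.2 < b ∧ p.1 ^ 2 + p.2.1 ^ 2 < g p.2.2} ⊆
      {q : Heis | q.2.2 ∈ Set.Icc a b ∧ q.1 ^ 2 + q.2.1 ^ 2 ≤ G q.2.2} := by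
    rintro q ⟨h₁, h₂, h₃⟩
    have hq : q.2.2 ∈ Set.Icc a b := ⟨h₁.le, h₂.le⟩
    exact ⟨hq, (hGg _ hq).symm ▸ h₃.le⟩
  obtain ⟨hz, hle⟩ := closure_minimal hsub hclosed hp
  exact ⟨hz, hGg _ hz ▸ hle⟩

/-- Contracting `[a, b]` towards an interior origin lands in the open interval. -/
theorem mul_mem_Ioo_of_mem_Icc {a b μ z : ℝ} (ha : a < 0) (hb : 0 < b) (hμ : 0 < μ) (hμ1 : μ < 1)
    (hz : z ∈ Set.Icc a b) : μ * z ∈ Set.Ioo a b :=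
  ⟨by nlinarith [mul_le_mul_of_nonneg_left hz.1 hμ.le],
    by nlinarith [mul_le_mul_of_nonneg_left hz.2 hμ.le]⟩

/-- A profile growing strictly slower than linearly under contraction yields a set with (S1). -/
theorem S1cond_of_lt_one_div_mul {a b : ℝ} (ha : a < 0) (hb : 0 < b) {g : ℝ → ℝ}
    (hg : ContinuousOn g (Set.Icc a b))
    (h : ∀ μ : ℝ, 0 < μ → μ < 1 → ∀ z ∈ Set.Icc a b, g z < (1 / μ) * g (μ * z)) :
    S1cond {p : Heis | a < p.2.2 ∧ p.2.2 < b ∧ p.1 ^ 2 + p.2.1 ^ 2 < g p.2.2} := by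
  intro μ hμ hμ1 p hp
  obtain ⟨hz, hle⟩ := mem_Icc_and_le_of_mem_closure (ha.trans hb).le hg hp
  have hsq : 0 < μ ^ 2 := by positivity
  have hsq1 : μ ^ 2 < 1 := pow_lt_one₀ hμ.le hμ1 two_ne_zero
  obtain ⟨h₁, h₂⟩ := mul_mem_Ioo_of_mem_Icc ha hb hsq hsq1 hz
  refine ⟨h₁, h₂, ?_⟩
  calc (μ * p.1) ^ 2 + (μ * p.2.1) ^ 2 = μ ^ 2 * (p.1 ^ 2 + p.2.1 ^ 2) := by ring
    _ ≤ μ ^ 2 * g p.2.2 := by gcongr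
    _ < μ ^ 2 * ((1 / μ ^ 2) * g (μ ^ 2 * p.2.2)) := by
      gcongr
      exact h _ hsq hsq1 _ hz
    _ = g (μ ^ 2 * p.2.2) := by field_simp

/-- A unimodal positive profile satisfies the contraction inequality. -/
theorem lt_one_div_mul_of_monotoneOn_antitoneOn {a b : ℝ} (ha : a < 0) (hb : 0 < b) {g : ℝ → ℝ}
    (hpos : ∀ z ∈ Set.Ioo a b, 0 < g z) (hmono : MonotoneOn g (Set.Icc a 0))
    (hanti : AntitoneOn g (Set.Icc 0 b)) {μ : ℝ} (hμ : 0 < μ) (hμ1 : μ < 1) {z : ℝ}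
    (hz : z ∈ Set.Icc a b) : g z < (1 / μ) * g (μ * z) := by
  have hm := mul_mem_Ioo_of_mem_Icc ha hb hμ hμ1 hz
  have hle : g z ≤ g (μ * z) := by
    rcases le_total z 0 with h0 | h0
    · exact hmono ⟨hz.1, h0⟩ ⟨hm.1.le, by nlinarith⟩ (by nlinarith)
    · exact hanti ⟨by positivity, hm.2.le⟩ ⟨h0, hz.2⟩ (by nlinarith)
  exact hle.trans_lt (lt_mul_of_one_lt_left (hpos _ hm) (one_lt_one_div hμ hμ1))

theorem statement18 (a b : ℝ) (ha : a < 0) (hb : 0 < b)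
    (g : ℝ → ℝ) (hg : ContDiffOn ℝ 2 g (Set.Icc a b))
    (hgpos : ∀ z ∈ Set.Ioo a b, 0 < g z) (hga : g a = 0) (hgb : g b = 0)
    (E₀ : Set Heis)
    (hE₀ : E₀ = {p : Heis | a < p.2.2 ∧ p.2.2 < b ∧ p.1 ^ 2 + p.2.1 ^ 2 < g p.2.2}) :
    ((∀ μ : ℝ, 0 < μ → μ < 1 → ∀ z ∈ Set.Icc a b, g z < (1 / μ) * g (μ * z)) →
      S1cond E₀) ∧
    ((MonotoneOn g (Set.Icc a 0) ∧ AntitoneOn g (Set.Icc 0 b)) → S1cond E₀) := by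
  subst hE₀
  exact ⟨S1cond_of_lt_one_div_mul ha hb hg.continuousOn, fun ⟨hmono, hanti⟩ =>
    S1cond_of_lt_one_div_mul ha hb hg.continuousOn fun _ hμ hμ1 _ hz =>
      lt_one_div_mul_of_monotoneOn_antitoneOn ha hb hgpos hmono hanti hμ hμ1 hz⟩
end
end
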